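/- arXiv:1610.05581 — 9 statements merged into one kernel-verified Lean document; each statement's English description precedes it below -/
import Mathlib

section
/- Let L be an abelian Lie algebra of dimension n over a field k. Then the 2-nilpotent multiplier M⁽²⁾(L) is an abelian Lie algebra of dimension (1/3)·n(n−1)(n+1); that is, for any free presentation 0 → R → F → L → 0, the k-vector space (R ∩ F³)/[[R,F],F] has dimension n(n−1)(n+1)/3. -/
open Module

universe u

section Preliminaries

variable (k : Type u) [Field k]

/-- The product of two Lie rings is a Lie ring with componentwise bracket. -/
instance prodLieRing (A B : Type u) [LieRing A] [LieRing B] : LieRing (A × B) where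
  bracket x y := (⁅x.1, y.1⁆, ⁅x.2, y.2⁆)
  add_lie x y z := by ext <;> exact add_lie ..
  lie_add x y z := by ext <;> exact lie_add ..
  lie_self x := by ext <;> exact lie_self _
  leibniz_lie x y z := by ext <;> exact leibniz_lie ..

/-- The product of two Lie algebras (the external direct sum `A ⊕ B`). -/
instance prodLieAlgebra (A B : Type u) [LieRing A] [LieRing B]
    [LieAlgebra k A] [LieAlgebra k B] : LieAlgebra k (A × B) where
  lie_smul t x y := by ext <;> exact lie_smul ..

/-- `L` is a Heisenberg Lie algebra `H(m)`: it has dimension `2m+1` and its derived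
subalgebra `L² = [L,L]` coincides with its centre `Z(L)` and has dimension `1`. -/
def IsHeisenberg (L : Type u) [LieRing L] [LieAlgebra k L] (m : ℕ) : Prop :=
  Module.finrank k L = 2 * m + 1 ∧
  LieModule.lowerCentralSeries k L L 1 = LieAlgebra.center k L ∧
  Module.finrank k (LieAlgebra.center k L) = 1

/-- The `k`-dimension of the quotient `A / (A ∩ B)` of a submodule `A` by a submodule `B`
(when `B ≤ A` this is the dimension of `A/B`). -/
noncomputable def subQuotRank {V : Type u} [AddCommGroup V] [Module k V]
    (A B : Submodule k V) : Cardinal.{u} :=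
  Module.rank k (↥A ⧸ B.comap A.subtype)

/-- The dimension of the 2-nilpotent multiplier `M⁽²⁾(L) = (R ∩ F³)/[[R,F],F]` computed from
the free presentation `π : F ↠ L` (with `F` a free Lie algebra and `R = ker π`). -/
noncomputable def m2Rank {X L : Type u} [LieRing L] [LieAlgebra k L]
    (π : FreeLieAlgebra k X →ₗ⁅k⁆ L) : Cardinal.{u} :=
  subQuotRank k
    (π.ker ⊓ LieModule.lowerCentralSeries k (FreeLieAlgebra k X) (FreeLieAlgebra k X) 2).toSubmodule
    (⁅(⁅π.ker, (⊤ : LieIdeal k (FreeLieAlgebra k X))⁆ : LieIdeal k (FreeLieAlgebra k X)),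
      (⊤ : LieIdeal k (FreeLieAlgebra k X))⁆ : LieIdeal k (FreeLieAlgebra k X)).toSubmodule

/-- A Lie algebra is 2-capable if it is isomorphic to `H/Z₂(H)` for some Lie algebra `H`,
where `Z₂(H)` is the second term of the upper central series of `H`. -/
def TwoCapable (L : Type u) [LieRing L] [LieAlgebra k L] : Prop :=
  ∃ (H : Type u) (_ : LieRing H) (_ : LieAlgebra k H),
    Nonempty (L ≃ₗ⁅k⁆ H ⧸ LieSubmodule.ucs 2 (⊥ : LieIdeal k H))

/-- A Lie algebra is capable if it is isomorphic to `H/Z(H)` for some Lie algebra `H`. -/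
def Capable (L : Type u) [LieRing L] [LieAlgebra k L] : Prop :=
  ∃ (H : Type u) (_ : LieRing H) (_ : LieAlgebra k H),
    Nonempty (L ≃ₗ⁅k⁆ H ⧸ LieAlgebra.center k H)

end Preliminaries

namespace M2Aux

open LieSubmodule

attribute [local instance 100] LieRing.ofAssociativeRing

abbrev Trip (n : ℕ) : Type := Σ j : Fin n, {i : Fin n // j < i} × {l : Fin n // j ≤ l}

theorem sum_aux (n : ℕ) : 3 * ∑ m ∈ Finset.range n, m * (m + 1) = n * (n - 1) * (n + 1) := by
  induction n with
  | zero => simp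
  | succ n ih =>
    rw [Finset.sum_range_succ, mul_add, ih]
    cases n with
    | zero => simp
    | succ n => simp only [Nat.add_sub_cancel]; ring

theorem card_trip (n : ℕ) : Fintype.card (Trip n) = n * (n - 1) * (n + 1) / 3 := by
  have h : Fintype.card (Trip n) = ∑ m ∈ Finset.range n, m * (m + 1) := by
    rw [Fintype.card_sigma, ← Finset.sum_range_reflect, ← Fin.sum_univ_eq_sum_range
      (fun j => (n - 1 - j) * (n - 1 - j + 1))]
    refine Finset.sum_congr rfl fun j _ => ?_
    rw [Fintype.card_prod]
    have h1 : Fintype.card {i : Fin n // j < i} = n - 1 - j := by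
      rw [Fintype.card_subtype, ← Fin.card_Ioi]; congr 1; ext; simp
    have h2 : Fintype.card {i : Fin n // j ≤ i} = n - j := by
      rw [Fintype.card_subtype, ← Fin.card_Ici]; congr 1; ext; simp
    rw [h1, h2]
    congr 1
    have := j.2
    omega
  rw [h, ← sum_aux]
  omega

variable {k : Type u} [Field k] {X : Type u}

theorem subalg_top (S : LieSubalgebra k (FreeLieAlgebra k X))
    (h : ∀ x, FreeLieAlgebra.of k x ∈ S) (y : FreeLieAlgebra k X) : y ∈ S := by
  let f : FreeLieAlgebra k X →ₗ⁅k⁆ S := FreeLieAlgebra.lift k (fun x => ⟨FreeLieAlgebra.of k x, h x⟩)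
  have : S.incl.comp f = LieHom.id := by
    ext x
    simp [f]
  have h2 := LieHom.congr_fun this y
  have h3 : ((f y : S) : FreeLieAlgebra k X) = y := h2
  rw [← h3]
  exact (f y).2

variable {L : Type u} [LieRing L] [LieAlgebra k L]

def mat (a b c : k) : Matrix (Fin 4) (Fin 4) k :=
  !![0, a, 0, 0; 0, 0, b, 0; 0, 0, 0, c; 0, 0, 0, 0]

noncomputable def rho (π : FreeLieAlgebra k X →ₗ⁅k⁆ L) (α β γ : L →ₗ[k] k) :
    FreeLieAlgebra k X →ₗ⁅k⁆ Matrix (Fin 4) (Fin 4) k :=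
  FreeLieAlgebra.lift k fun x =>
    mat (α (π (FreeLieAlgebra.of k x))) (β (π (FreeLieAlgebra.of k x)))
      (γ (π (FreeLieAlgebra.of k x)))

def Good (π : FreeLieAlgebra k X →ₗ⁅k⁆ L) (α β γ : L →ₗ[k] k) (y : FreeLieAlgebra k X) : Prop :=
  (∀ i j : Fin 4, j ≤ i → rho π α β γ y i j = 0) ∧ rho π α β γ y 0 1 = α (π y) ∧
    rho π α β γ y 1 2 = β (π y) ∧ rho π α β γ y 2 3 = γ (π y)

theorem lie_entry (A B : Matrix (Fin 4) (Fin 4) k) (i j : Fin 4) :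
    ⁅A, B⁆ i j = (A i 0 * B 0 j + A i 1 * B 1 j + A i 2 * B 2 j + A i 3 * B 3 j)
      - (B i 0 * A 0 j + B i 1 * A 1 j + B i 2 * A 2 j + B i 3 * A 3 j) := by
  rw [Ring.lie_def, Matrix.sub_apply, Matrix.mul_apply, Matrix.mul_apply, Fin.sum_univ_four,
    Fin.sum_univ_four]

set_option maxHeartbeats 2000000 in
theorem good [IsLieAbelian L] (π : FreeLieAlgebra k X →ₗ⁅k⁆ L) (α β γ : L →ₗ[k] k)
    (y : FreeLieAlgebra k X) : Good π α β γ y := by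
  let S : LieSubalgebra k (FreeLieAlgebra k X) :=
    { carrier := {y | Good π α β γ y}
      add_mem' := by
        rintro a b ⟨h1, h2, h3, h4⟩ ⟨g1, g2, g3, g4⟩
        refine ⟨fun i j hij => ?_, ?_, ?_, ?_⟩
        · simp [h1 i j hij, g1 i j hij]
        all_goals simp [*]
      zero_mem' := by simp [Good]
      smul_mem' := by
        rintro c a ⟨h1, h2, h3, h4⟩
        refine ⟨fun i j hij => ?_, ?_, ?_, ?_⟩
        · simp [h1 i j hij]
        all_goals simp [*]
      lie_mem' := by
        rintro a b ⟨h1, h2, h3, h4⟩ ⟨g1, g2, g3, g4⟩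
        have z : π ⁅a, b⁆ = 0 := by rw [LieHom.map_lie]; exact trivial_lie_zero _ _ _ _
        refine ⟨fun i j hij => ?_, ?_, ?_, ?_⟩
        · rw [LieHom.map_lie, lie_entry]
          fin_cases i <;> fin_cases j <;> first | (exfalso; revert hij; decide) | simp [h1, g1]
        all_goals rw [LieHom.map_lie, lie_entry, z]; simp [h1, g1] }
  refine subalg_top S (fun x => ?_) y
  change Good π α β γ _
  refine ⟨fun i j hij => ?_, ?_, ?_, ?_⟩
  · simp only [rho, FreeLieAlgebra.lift_of_apply]
    fin_cases i <;> fin_cases j <;> first | (exfalso; revert hij; decide) | simp [mat]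
  all_goals simp [rho, mat]

theorem rho_triple [IsLieAbelian L] (π : FreeLieAlgebra k X →ₗ⁅k⁆ L) (α β γ : L →ₗ[k] k)
    (a b c : FreeLieAlgebra k X) :
    rho π α β γ ⁅⁅a, b⁆, c⁆ 0 3 =
      (α (π a) * β (π b) - α (π b) * β (π a)) * γ (π c)
        - α (π c) * (β (π a) * γ (π b) - β (π b) * γ (π a)) := by
  obtain ⟨a1, a2, a3, a4⟩ := good π α β γ a
  obtain ⟨b1, b2, b3, b4⟩ := good π α β γ b
  obtain ⟨c1, c2, c3, c4⟩ := good π α β γ c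
  rw [LieHom.map_lie, LieHom.map_lie, lie_entry]
  simp only [lie_entry]
  simp [a1, b1, c1, a2, a3, a4, b2, b3, b4, c2, c4]

/-- the ideal `[[R,F],F]` -/
noncomputable abbrev J (π : FreeLieAlgebra k X →ₗ⁅k⁆ L) : LieIdeal k (FreeLieAlgebra k X) :=
  ⁅(⁅π.ker, (⊤ : LieIdeal k (FreeLieAlgebra k X))⁆ : LieIdeal k (FreeLieAlgebra k X)),
      (⊤ : LieIdeal k (FreeLieAlgebra k X))⁆

theorem J_le (π : FreeLieAlgebra k X →ₗ⁅k⁆ L) (P : Submodule k (FreeLieAlgebra k X))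
    (h : ∀ r a b : FreeLieAlgebra k X, π r = 0 → ⁅⁅r, a⁆, b⁆ ∈ P) : (J π).toSubmodule ≤ P := by
  rw [LieSubmodule.lieIdeal_oper_eq_linear_span', Submodule.span_le]
  rintro _ ⟨x, hx, b, -, rfl⟩
  let f : FreeLieAlgebra k X →ₗ[k] FreeLieAlgebra k X :=
    (LieModule.toEnd k (FreeLieAlgebra k X) (FreeLieAlgebra k X)).toLinearMap.flip b
  have hf : ∀ x, f x = ⁅x, b⁆ := fun _ => rfl
  have : (⁅π.ker, (⊤ : LieIdeal k (FreeLieAlgebra k X))⁆ : LieIdeal k _).toSubmodule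
      ≤ P.comap f := by
    rw [LieSubmodule.lieIdeal_oper_eq_linear_span', Submodule.span_le]
    rintro _ ⟨r, hr, a, -, rfl⟩
    exact h r a b (LieHom.mem_ker.1 hr)
  exact this hx

theorem mem_J (π : FreeLieAlgebra k X →ₗ⁅k⁆ L) (r a b : FreeLieAlgebra k X) (h : π r = 0) :
    ⁅⁅r, a⁆, b⁆ ∈ (J π).toSubmodule :=
  LieSubmodule.lie_mem_lie (LieSubmodule.lie_mem_lie (LieHom.mem_ker.2 h)
    (LieSubmodule.mem_top _)) (LieSubmodule.mem_top _)

noncomputable abbrev F3 (k : Type u) [Field k] (X : Type u) : LieIdeal k (FreeLieAlgebra k X) :=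
  LieModule.lowerCentralSeries k (FreeLieAlgebra k X) (FreeLieAlgebra k X) 2

theorem F3_le (P : Submodule k (FreeLieAlgebra k X))
    (h : ∀ a b c : FreeLieAlgebra k X, ⁅⁅a, b⁆, c⁆ ∈ P) : (F3 k X).toSubmodule ≤ P := by
  change (⁅(⊤ : LieIdeal k (FreeLieAlgebra k X)), LieModule.lowerCentralSeries k (FreeLieAlgebra k X) (FreeLieAlgebra k X) 1⁆ : LieIdeal k _).toSubmodule ≤ P
  rw [LieSubmodule.lieIdeal_oper_eq_linear_span', Submodule.span_le]
  rintro _ ⟨c, -, x, hx, rfl⟩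
  have : (⁅(⊤ : LieIdeal k (FreeLieAlgebra k X)), (⊤ : LieIdeal k (FreeLieAlgebra k X))⁆ : LieIdeal k _).toSubmodule
      ≤ P.comap (LieModule.toEnd k (FreeLieAlgebra k X) (FreeLieAlgebra k X) c) := by
    rw [LieSubmodule.lieIdeal_oper_eq_linear_span', Submodule.span_le]
    rintro _ ⟨a, ha, b, -, rfl⟩
    change ⁅c, ⁅a, b⁆⁆ ∈ P
    rw [← lie_skew]
    exact P.neg_mem (h a b c)
  exact this hx

theorem mem_F3 (a b c : FreeLieAlgebra k X) : ⁅⁅a, b⁆, c⁆ ∈ (F3 k X).toSubmodule := by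
  rw [← lie_skew]
  refine Submodule.neg_mem _ ?_
  change ⁅c, ⁅a, b⁆⁆ ∈ ⁅(⊤ : LieIdeal k (FreeLieAlgebra k X)), LieModule.lowerCentralSeries k (FreeLieAlgebra k X) (FreeLieAlgebra k X) 1⁆
  refine LieSubmodule.lie_mem_lie (LieSubmodule.mem_top _) ?_
  change ⁅a, b⁆ ∈ ⁅(⊤ : LieIdeal k (FreeLieAlgebra k X)), (⊤ : LieIdeal k (FreeLieAlgebra k X))⁆
  exact LieSubmodule.lie_mem_lie (LieSubmodule.mem_top _) (LieSubmodule.mem_top _)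

theorem F3_le_ker [IsLieAbelian L] (π : FreeLieAlgebra k X →ₗ⁅k⁆ L) :
    F3 k X ≤ π.ker := by
  refine F3_le (π.ker).toSubmodule fun a b c => ?_
  refine LieHom.mem_ker.2 ?_
  rw [LieHom.map_lie]; exact trivial_lie_zero _ _ _ _

section
variable {n : ℕ} (e : Fin n → FreeLieAlgebra k X)

/-- basic commutators -/
noncomputable def bas (t : Trip n) : FreeLieAlgebra k X := ⁅⁅e t.2.1, e t.1⁆, e t.2.2⁆

theorem bas_mem (P : Submodule k (FreeLieAlgebra k X)) (h : ∀ t, bas e t ∈ P) (i j l : Fin n) :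
    ⁅⁅e i, e j⁆, e l⁆ ∈ P := by
  have key : ∀ i j l, j < i → ⁅⁅e i, e j⁆, e l⁆ ∈ P := by
    intro i j l hij
    rcases le_or_gt j l with hjl | hjl
    · exact h ⟨j, ⟨i, hij⟩, ⟨l, hjl⟩⟩
    · have h1 := h ⟨l, ⟨j, hjl⟩, ⟨i, (hjl.trans hij).le⟩⟩
      have h2 := h ⟨l, ⟨i, hjl.trans hij⟩, ⟨j, hjl.le⟩⟩
      simp only [bas] at h1 h2
      have : ⁅⁅e i, e j⁆, e l⁆ = ⁅⁅e i, e l⁆, e j⁆ - ⁅⁅e j, e l⁆, e i⁆ := by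
        rw [lie_lie, ← lie_skew ⁅e i, e l⁆, ← lie_skew ⁅e j, e l⁆]; abel
      rw [this]
      exact P.sub_mem h2 h1
  rcases lt_trichotomy i j with hij | rfl | hij
  · rw [← lie_skew (e i), neg_lie]; exact P.neg_mem (key j i l hij)
  · simp
  · exact key i j l hij

theorem gen_top (π : FreeLieAlgebra k X →ₗ⁅k⁆ L) (b : Basis (Fin n) k L)
    (he : ∀ i, π (e i) = b i) (P : Submodule k (FreeLieAlgebra k X))
    (h1 : ∀ r, π r = 0 → r ∈ P) (h2 : ∀ i, e i ∈ P) (y : FreeLieAlgebra k X) : y ∈ P := by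
  have h3 : ∑ i, b.repr (π y) i • e i ∈ P := P.sum_mem fun i _ => P.smul_mem _ (h2 i)
  have h4 : y - ∑ i, b.repr (π y) i • e i ∈ P := by
    apply h1
    rw [map_sub, map_sum]
    simp only [map_smul, he, b.sum_repr, sub_self]
  simpa using P.add_mem h4 h3

theorem all_mem (π : FreeLieAlgebra k X →ₗ⁅k⁆ L) (b : Basis (Fin n) k L)
    (he : ∀ i, π (e i) = b i) (P : Submodule k (FreeLieAlgebra k X))
    (hJ : (J π).toSubmodule ≤ P) (h : ∀ t, bas e t ∈ P) (x y z : FreeLieAlgebra k X) :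
    ⁅⁅x, y⁆, z⁆ ∈ P := by
  let ad := (LieModule.toEnd k (FreeLieAlgebra k X) (FreeLieAlgebra k X)).toLinearMap
  have s1 : ∀ i j z, ⁅⁅e i, e j⁆, z⁆ ∈ P := fun i j z => by
    refine gen_top e π b he (P.comap (ad ⁅e i, e j⁆)) (fun r hr => ?_)
      (fun l => bas_mem e P h i j l) z
    change ⁅⁅e i, e j⁆, r⁆ ∈ P
    have : ⁅⁅e i, e j⁆, r⁆ = ⁅⁅r, e j⁆, e i⁆ - ⁅⁅r, e i⁆, e j⁆ := by
      rw [lie_lie, ← lie_skew ⁅r, e i⁆, ← lie_skew ⁅r, e j⁆, ← lie_skew r, ← lie_skew r]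
      simp only [lie_neg]; abel
    rw [this]
    exact P.sub_mem (hJ (mem_J π _ _ _ hr)) (hJ (mem_J π _ _ _ hr))
  have s2 : ∀ i y z, ⁅⁅e i, y⁆, z⁆ ∈ P := fun i y z => by
    refine gen_top e π b he (P.comap (ad.flip z ∘ₗ ad (e i))) (fun r hr => ?_)
      (fun l => s1 i l z) y
    change ⁅⁅e i, r⁆, z⁆ ∈ P
    rw [← lie_skew (e i), neg_lie]
    exact P.neg_mem (hJ (mem_J π _ _ _ hr))
  refine gen_top e π b he (P.comap (ad.flip z ∘ₗ ad.flip y)) (fun r hr => ?_)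
      (fun l => s2 l y z) x
  exact hJ (mem_J π _ _ _ hr)

/-- dual functional -/
noncomputable def psi (π : FreeLieAlgebra k X →ₗ⁅k⁆ L) (b : Basis (Fin n) k L) (t : Trip n) :
    FreeLieAlgebra k X →ₗ[k] k :=
  if (t.2.2 : Fin n) = t.1 then
    (Matrix.entryLinearMap k k 0 3) ∘ₗ
      (rho π (b.coord t.2.1) (b.coord t.1) (b.coord t.2.2)).toLinearMap
  else
    -((Matrix.entryLinearMap k k 0 3) ∘ₗ
      (rho π (b.coord t.1) (b.coord t.2.1) (b.coord t.2.2)).toLinearMap)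

theorem psi_J [IsLieAbelian L] (π : FreeLieAlgebra k X →ₗ⁅k⁆ L) (b : Basis (Fin n) k L)
    (t : Trip n) (y : FreeLieAlgebra k X) (hy : y ∈ (J π).toSubmodule) : psi π b t y = 0 := by
  have : (J π).toSubmodule ≤ LinearMap.ker (psi π b t) := by
    refine J_le π _ fun r x z hr => ?_
    rw [LinearMap.mem_ker, psi]
    split_ifs
    · change rho _ _ _ _ ⁅⁅r, x⁆, z⁆ 0 3 = 0
      rw [rho_triple, hr]; simp
    · change -(rho _ _ _ _ ⁅⁅r, x⁆, z⁆ 0 3) = 0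
      rw [rho_triple, hr]; simp
  exact this hy

theorem psi_bas [IsLieAbelian L] (π : FreeLieAlgebra k X →ₗ⁅k⁆ L) (b : Basis (Fin n) k L)
    (he : ∀ i, π (e i) = b i) (s t : Trip n) :
    psi π b s (bas e t) = if s = t then 1 else 0 := by
  obtain ⟨j, ⟨i, hij⟩, ⟨l, hjl⟩⟩ := s
  obtain ⟨j', ⟨i', hij'⟩, ⟨l', hjl'⟩⟩ := t
  have hst : ((⟨j, ⟨i, hij⟩, ⟨l, hjl⟩⟩ : Trip n) = ⟨j', ⟨i', hij'⟩, ⟨l', hjl'⟩⟩) ↔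
      (j = j' ∧ i = i' ∧ l = l') := by
    constructor
    · intro h; cases h; exact ⟨rfl, rfl, rfl⟩
    · rintro ⟨rfl, rfl, rfl⟩; rfl
  rw [if_congr hst rfl rfl]
  simp only [psi, bas]
  have hc : ∀ p q, b.coord p (b q) = if q = p then 1 else 0 := fun p q => by
    simp [Finsupp.single_apply]
  split_ifs with h1 h2 h2
  all_goals first
    | change rho _ _ _ _ ⁅⁅_, _⁆, _⁆ 0 3 = _
    | change -(rho _ _ _ _ ⁅⁅_, _⁆, _⁆ 0 3) = _
  all_goals
    rw [rho_triple]
    simp only [he, hc]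
    grind

end

theorem main [IsLieAbelian L] {n : ℕ} (π : FreeLieAlgebra k X →ₗ⁅k⁆ L)
    (b : Basis (Fin n) k L) (e : Fin n → FreeLieAlgebra k X) (he : ∀ i, π (e i) = b i) :
    subQuotRank k (F3 k X).toSubmodule (J π).toSubmodule = (Fintype.card (Trip n) : ℕ) := by
  unfold subQuotRank
  set A := (F3 k X).toSubmodule
  set K := (J π).toSubmodule.comap A.subtype
  let v : Trip n → A ⧸ K := fun t => K.mkQ ⟨bas e t, mem_F3 _ _ _⟩
  let f : Trip n → (A ⧸ K →ₗ[k] k) := fun t => K.liftQ (psi π b t ∘ₗ A.subtype) (by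
    intro y hy
    exact psi_J π b t _ hy)
  have hfv : ∀ s t, f s (v t) = if s = t then 1 else 0 := fun s t => psi_bas e π b he s t
  have hli : LinearIndependent k v := by
    rw [Fintype.linearIndependent_iff]
    intro g hg s
    have := congrArg (f s) hg
    simpa [hfv] using this
  have hsp : ⊤ ≤ Submodule.span k (Set.range v) := by
    have h1 : A ≤ ((Submodule.span k (Set.range v)).comap K.mkQ).map A.subtype ⊔ (J π).toSubmodule := by
      refine F3_le _ (all_mem e π b he _ le_sup_right fun t => ?_)
      refine Submodule.mem_sup_left ⟨⟨bas e t, mem_F3 _ _ _⟩, ?_, rfl⟩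
      exact Submodule.subset_span ⟨t, rfl⟩
    rintro y -
    obtain ⟨⟨a, ha⟩, rfl⟩ := K.mkQ_surjective y
    obtain ⟨_, ⟨⟨x, hxA⟩, hx, rfl⟩, z, hz, hxz⟩ := Submodule.mem_sup.1 (h1 ha)
    have : K.mkQ ⟨a, ha⟩ = K.mkQ ⟨x, hxA⟩ := by
      rw [← sub_eq_zero, ← map_sub, ← LinearMap.mem_ker, Submodule.ker_mkQ]
      change a - x ∈ (J π).toSubmodule
      rw [← hxz]
      simpa using hz
    rw [this]
    exact hx
  exact rank_eq_card_basis (Basis.mk hli hsp)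

end M2Aux

/-- If `L` is an abelian Lie algebra of dimension `n` over a field `k`, then for
any free presentation `0 → R → F → L → 0` the `k`-vector space `(R ∩ F³)/[[R,F],F]` (i.e. the
2-nilpotent multiplier `M⁽²⁾(L)`) has dimension `n(n-1)(n+1)/3`. -/
theorem stmt_0 (k : Type u) [Field k] (L : Type u) [LieRing L] [LieAlgebra k L]
    [FiniteDimensional k L] (hab : IsLieAbelian L) (n : ℕ) (hn : Module.finrank k L = n)
    (X : Type u) (π : FreeLieAlgebra k X →ₗ⁅k⁆ L) (hπ : Function.Surjective π) :
    m2Rank k π = ((n * (n - 1) * (n + 1)) / 3 : ℕ) := by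
  have := hab
  unfold m2Rank
  let b : Basis (Fin n) k L := Module.finBasisOfFinrankEq k L hn
  choose e he using fun i => hπ (b i)
  have h : π.ker ⊓ LieModule.lowerCentralSeries k (FreeLieAlgebra k X) (FreeLieAlgebra k X) 2
      = M2Aux.F3 k X := inf_eq_right.2 (M2Aux.F3_le_ker π)
  rw [h, ← M2Aux.card_trip]
  exact M2Aux.main π b e he
end

section
/- Let L be a Heisenberg Lie algebra H(1) over a field k (so dim L = 3). Then the 2-nilpotent multiplier M⁽²⁾(L) is an abelian Lie algebra of dimension 5. -/
open Module

universe u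

/-- Free nilpotent Lie algebra of class 4 on two generators, in coordinates. -/
def NFour (k : Type u) : Type u := Fin 8 → k

section NF
variable (k : Type u) [Field k]

instance : AddCommGroup (NFour k) := inferInstanceAs (AddCommGroup (Fin 8 → k))
instance : Module k (NFour k) := inferInstanceAs (Module k (Fin 8 → k))

variable {k}

theorem NFour.add_apply (v w : NFour k) (i : Fin 8) : (v + w) i = v i + w i := rfl
theorem NFour.smul_apply (t : k) (w : NFour k) (i : Fin 8) : (t • w) i = t * w i := rfl
theorem NFour.zero_apply (i : Fin 8) : (0 : NFour k) i = 0 := rfl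

/-- bracket -/
def NFour.br (v w : NFour k) : NFour k :=
  ![0, 0, v 0 * w 1 - v 1 * w 0,
    v 0 * w 2 - v 2 * w 0,
    v 1 * w 2 - v 2 * w 1,
    v 0 * w 3 - v 3 * w 0,
    v 0 * w 4 - v 4 * w 0 + v 1 * w 3 - v 3 * w 1,
    v 1 * w 4 - v 4 * w 1]

theorem NFour.br0 (v w : NFour k) : NFour.br v w 0 = 0 := rfl
theorem NFour.br1 (v w : NFour k) : NFour.br v w 1 = 0 := rfl
theorem NFour.br2 (v w : NFour k) : NFour.br v w 2 = v 0 * w 1 - v 1 * w 0 := rfl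
theorem NFour.br3 (v w : NFour k) : NFour.br v w 3 = v 0 * w 2 - v 2 * w 0 := rfl
theorem NFour.br4 (v w : NFour k) : NFour.br v w 4 = v 1 * w 2 - v 2 * w 1 := rfl
theorem NFour.br5 (v w : NFour k) : NFour.br v w 5 = v 0 * w 3 - v 3 * w 0 := rfl
theorem NFour.br6 (v w : NFour k) :
    NFour.br v w 6 = v 0 * w 4 - v 4 * w 0 + v 1 * w 3 - v 3 * w 1 := rfl
theorem NFour.br7 (v w : NFour k) : NFour.br v w 7 = v 1 * w 4 - v 4 * w 1 := rfl

theorem NFour.ext8 {v w : NFour k} (h0 : v 0 = w 0) (h1 : v 1 = w 1) (h2 : v 2 = w 2)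
    (h3 : v 3 = w 3) (h4 : v 4 = w 4) (h5 : v 5 = w 5) (h6 : v 6 = w 6) (h7 : v 7 = w 7) :
    v = w := by
  funext i
  fin_cases i <;> assumption

instance : LieRing (NFour k) where
  bracket := NFour.br
  add_lie x y z := by
    change NFour.br _ _ = NFour.br _ _ + NFour.br _ _
    apply NFour.ext8 <;> simp only [NFour.add_apply, NFour.br0, NFour.br1, NFour.br2, NFour.br3,
      NFour.br4, NFour.br5, NFour.br6, NFour.br7] <;> ring
  lie_add x y z := by
    change NFour.br _ _ = NFour.br _ _ + NFour.br _ _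
    apply NFour.ext8 <;> simp only [NFour.add_apply, NFour.br0, NFour.br1, NFour.br2, NFour.br3,
      NFour.br4, NFour.br5, NFour.br6, NFour.br7] <;> ring
  lie_self x := by
    change NFour.br _ _ = 0
    apply NFour.ext8 <;> simp only [NFour.zero_apply, NFour.br0, NFour.br1, NFour.br2, NFour.br3,
      NFour.br4, NFour.br5, NFour.br6, NFour.br7] <;> ring
  leibniz_lie x y z := by
    change NFour.br _ (NFour.br _ _) = NFour.br (NFour.br _ _) _ + NFour.br _ (NFour.br _ _)
    apply NFour.ext8 <;> simp only [NFour.add_apply, NFour.br0, NFour.br1, NFour.br2, NFour.br3,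
      NFour.br4, NFour.br5, NFour.br6, NFour.br7] <;> ring

instance : LieAlgebra k (NFour k) where
  lie_smul t x y := by
    change NFour.br _ _ = t • NFour.br _ _
    apply NFour.ext8 <;> simp only [NFour.smul_apply, NFour.br0, NFour.br1, NFour.br2, NFour.br3,
      NFour.br4, NFour.br5, NFour.br6, NFour.br7] <;> ring

theorem NFour.lie_def (v w : NFour k) : ⁅v, w⁆ = NFour.br v w := rfl

/-- coordinates in degrees three and four -/
def NFour.top (k : Type u) [Field k] : NFour k →ₗ[k] (Fin 5 → k) where
  toFun v := ![v 3, v 4, v 5, v 6, v 7]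
  map_add' v w := by
    funext i; fin_cases i <;> rfl
  map_smul' t v := by
    funext i; fin_cases i <;> rfl

theorem NFour.top_apply (v : NFour k) : NFour.top k v = ![v 3, v 4, v 5, v 6, v 7] := rfl

/-- projection onto the Heisenberg algebra -/
def NFour.proj {L : Type u} [LieRing L] [LieAlgebra k L] (a b : L)
    (hc : ∀ u : L, ⁅u, ⁅a, b⁆⁆ = 0) : NFour k →ₗ⁅k⁆ L where
  toFun v := v 0 • a + v 1 • b + v 2 • ⁅a, b⁆
  map_add' v w := by simp only [NFour.add_apply]; module
  map_smul' t v := by simp only [NFour.smul_apply, RingHom.id_apply]; module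
  map_lie' := by
    intro v w
    have hc' : ∀ u : L, ⁅⁅a, b⁆, u⁆ = 0 := fun u => by rw [← lie_skew, hc, neg_zero]
    have hba : ⁅b, a⁆ = -⁅a, b⁆ := (lie_skew _ _).symm
    simp only [NFour.lie_def, NFour.br0, NFour.br1, NFour.br2, add_lie, lie_add, smul_lie,
      lie_smul, hc, hc', lie_self, hba]
    module

theorem NFour.proj_apply {L : Type u} [LieRing L] [LieAlgebra k L] (a b : L)
    (hc : ∀ u : L, ⁅u, ⁅a, b⁆⁆ = 0) (v : NFour k) :
    NFour.proj a b hc v = v 0 • a + v 1 • b + v 2 • ⁅a, b⁆ := rfl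

end NF

section Heis
variable {k : Type u} [Field k] {L : Type u} [LieRing L] [LieAlgebra k L]

theorem heis_gens (hL : IsHeisenberg k L 1) :
    ∃ a b : L, (∀ u : L, ⁅u, ⁅a, b⁆⁆ = 0) ∧
      (∀ p q r : k, p • a + q • b + r • ⁅a, b⁆ = 0 → p = 0 ∧ q = 0 ∧ r = 0) ∧
      ∀ u : L, ∃ p q r : k, u = p • a + q • b + r • ⁅a, b⁆ := by
  obtain ⟨h3, hZ, h1⟩ := hL
  have hcen : ∀ a b u : L, ⁅u, ⁅a, b⁆⁆ = 0 := by
    intro a b u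
    have : ⁅a, b⁆ ∈ LieAlgebra.center k L := by
      rw [← hZ, LieModule.lowerCentralSeries_succ, LieModule.lowerCentralSeries_zero]
      exact LieSubmodule.lie_mem_lie trivial trivial
    exact (LieModule.mem_maxTrivSubmodule k L L _).1 this u
  have hex : ∃ a b : L, ⁅a, b⁆ ≠ 0 := by
    by_contra! h
    have : LieAlgebra.center k L = ⊤ := by
      rw [eq_top_iff]
      intro x _
      exact (LieModule.mem_maxTrivSubmodule k L L _).2 fun y => h y x
    rw [this] at h1
    have h2 : finrank k (⊤ : Submodule k L) = 1 := h1
    rw [finrank_top] at h2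
    omega
  obtain ⟨a, b, hab⟩ := hex
  have hc := hcen a b
  have hind : ∀ p q r : k, p • a + q • b + r • ⁅a, b⁆ = 0 → p = 0 ∧ q = 0 ∧ r = 0 := by
    intro p q r h
    have e1 : ⁅b, p • a + q • b + r • ⁅a, b⁆⁆ = 0 := by rw [h, lie_zero]
    have e2 : ⁅a, p • a + q • b + r • ⁅a, b⁆⁆ = 0 := by rw [h, lie_zero]
    simp only [lie_add, lie_smul, hc, lie_self, smul_zero, add_zero, zero_add] at e1 e2
    rw [← lie_skew, smul_neg, neg_eq_zero, smul_eq_zero] at e1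
    rw [smul_eq_zero] at e2
    have hp := e1.resolve_right hab
    have hq := e2.resolve_right hab
    subst hp hq
    simp only [zero_smul, zero_add, smul_eq_zero] at h
    exact ⟨rfl, rfl, h.resolve_right hab⟩
  refine ⟨a, b, hc, hind, ?_⟩
  have hli : LinearIndependent k ![a, b, ⁅a, b⁆] := by
    rw [Fintype.linearIndependent_iff]
    intro g hg
    simp only [Fin.sum_univ_three, Matrix.cons_val_zero, Matrix.cons_val_one,
      Matrix.cons_val] at hg
    obtain ⟨h0, h1, h2⟩ := hind _ _ _ hg
    intro i
    fin_cases i <;> assumption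
  have hspan := hli.span_eq_top_of_card_eq_finrank (by simp [h3])
  intro u
  have hu : u ∈ Submodule.span k (Set.range ![a, b, ⁅a, b⁆]) := by rw [hspan]; trivial
  obtain ⟨g, hg⟩ := (Submodule.mem_span_range_iff_exists_fun k).1 hu
  refine ⟨g 0, g 1, g 2, ?_⟩
  rw [← hg]
  simp [Fin.sum_univ_three]

end Heis

section Span
variable {k : Type u} [Field k] {F : Type u} [LieRing F] [LieAlgebra k F]

theorem two_step_left (R : LieIdeal k F) {r : F} (hr : r ∈ R) (u w : F) :
    ⁅u, ⁅r, w⁆⁆ ∈ (⁅(⁅R, (⊤ : LieIdeal k F)⁆ : LieIdeal k F), (⊤ : LieIdeal k F)⁆ :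
      LieIdeal k F) := by
  rw [← lie_skew]
  apply neg_mem
  exact LieSubmodule.lie_mem_lie (LieSubmodule.lie_mem_lie hr trivial) trivial

theorem two_step_right (R : LieIdeal k F) {r : F} (hr : r ∈ R) (u w : F) :
    ⁅u, ⁅w, r⁆⁆ ∈ (⁅(⁅R, (⊤ : LieIdeal k F)⁆ : LieIdeal k F), (⊤ : LieIdeal k F)⁆ :
      LieIdeal k F) := by
  rw [← lie_skew w r, lie_neg]
  exact neg_mem (two_step_left R hr u w)

theorem two_step_out (R : LieIdeal k F) {r : F} (hr : r ∈ R) (u w : F) :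
    ⁅r, ⁅u, w⁆⁆ ∈ (⁅(⁅R, (⊤ : LieIdeal k F)⁆ : LieIdeal k F), (⊤ : LieIdeal k F)⁆ :
      LieIdeal k F) := by
  rw [leibniz_lie]
  refine add_mem ?_ (two_step_left R hr u w)
  exact LieSubmodule.lie_mem_lie (LieSubmodule.lie_mem_lie hr trivial) trivial

/-- the five elements -/
def five (x y : F) : Fin 5 → F :=
  ![⁅x, ⁅x, y⁆⁆, ⁅y, ⁅x, y⁆⁆, ⁅x, ⁅x, ⁅x, y⁆⁆⁆, ⁅y, ⁅x, ⁅x, y⁆⁆⁆, ⁅y, ⁅y, ⁅x, y⁆⁆⁆]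

theorem triple_mem (R : LieIdeal k F) (x y : F)
    (hT : ∀ u : F, ∃ p q s : k, ∃ r ∈ R, u = p • x + q • y + s • ⁅x, y⁆ + r)
    (h1 : ⁅x, ⁅x, y⁆⁆ ∈ R) (h2 : ⁅y, ⁅x, y⁆⁆ ∈ R) (u v w : F) :
    ⁅u, ⁅v, w⁆⁆ ∈ Submodule.span k (Set.range (five x y)) ⊔
      (⁅(⁅R, (⊤ : LieIdeal k F)⁆ : LieIdeal k F), (⊤ : LieIdeal k F)⁆ :
      LieIdeal k F).toSubmodule := by
  set I := (⁅(⁅R, (⊤ : LieIdeal k F)⁆ : LieIdeal k F), (⊤ : LieIdeal k F)⁆ : LieIdeal k F) with hI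
  set P := Submodule.span k (Set.range (five x y)) ⊔ I.toSubmodule with hP
  have hIP : ∀ f ∈ I, f ∈ P := fun f hf => Submodule.mem_sup_right hf
  have hm : ∀ i, five x y i ∈ P := fun i =>
    Submodule.mem_sup_left (Submodule.subset_span ⟨i, rfl⟩)
  have m0 : ⁅x, ⁅x, y⁆⁆ ∈ P := hm 0
  have m1 : ⁅y, ⁅x, y⁆⁆ ∈ P := hm 1
  have m2 : ⁅x, ⁅x, ⁅x, y⁆⁆⁆ ∈ P := hm 2
  have m3 : ⁅y, ⁅x, ⁅x, y⁆⁆⁆ ∈ P := hm 3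
  have m4 : ⁅y, ⁅y, ⁅x, y⁆⁆⁆ ∈ P := hm 4
  have m3' : ⁅x, ⁅y, ⁅x, y⁆⁆⁆ ∈ P := by
    rw [leibniz_lie x y, lie_self, zero_add]; exact m3
  have mz : ∀ r ∈ R, ⁅⁅x, y⁆, r⁆ ∈ P := by
    intro r hr
    rw [lie_lie]
    exact sub_mem (hIP _ (two_step_right R hr _ _)) (hIP _ (two_step_right R hr _ _))
  have hu : ∀ f : F, ⁅x, f⁆ ∈ P → ⁅y, f⁆ ∈ P → ⁅⁅x, y⁆, f⁆ ∈ P → (∀ r ∈ R, ⁅r, f⁆ ∈ P) →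
      ∀ u : F, ⁅u, f⁆ ∈ P := by
    intro f h1 h2 h3 h4 u
    obtain ⟨p, q, s, r, hr, rfl⟩ := hT u
    simp only [add_lie, smul_lie]
    exact add_mem (add_mem (add_mem (P.smul_mem _ h1) (P.smul_mem _ h2)) (P.smul_mem _ h3))
      (h4 r hr)
  have uz : ∀ u : F, ⁅u, ⁅x, y⁆⁆ ∈ P := hu _ m0 m1 (by rw [lie_self]; exact zero_mem _)
    fun r hr => hIP _ (two_step_out R hr _ _)
  have um1 : ∀ u : F, ⁅u, ⁅x, ⁅x, y⁆⁆⁆ ∈ P := hu _ m2 m3 (mz _ h1)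
    fun r hr => hIP _ (two_step_out R hr _ _)
  have um2 : ∀ u : F, ⁅u, ⁅y, ⁅x, y⁆⁆⁆ ∈ P := hu _ m3' m4 (mz _ h2)
    fun r hr => hIP _ (two_step_out R hr _ _)
  obtain ⟨p, q, s, r, hr, rfl⟩ := hT v
  obtain ⟨p', q', s', r', hr', rfl⟩ := hT w
  have key : ⁅p • x + q • y + s • ⁅x, y⁆ + r, p' • x + q' • y + s' • ⁅x, y⁆ + r'⁆ =
      (p * q' - q * p') • ⁅x, y⁆ + (p * s' - s * p') • ⁅x, ⁅x, y⁆⁆ +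
      (q * s' - s * q') • ⁅y, ⁅x, y⁆⁆ + ⁅r, p' • x + q' • y + s' • ⁅x, y⁆ + r'⁆ +
      ⁅p • x + q • y + s • ⁅x, y⁆, r'⁆ := by
    have e1 : ⁅y, x⁆ = -⁅x, y⁆ := (lie_skew _ _).symm
    have e2 : ⁅⁅x, y⁆, x⁆ = -⁅x, ⁅x, y⁆⁆ := (lie_skew _ _).symm
    have e3 : ⁅⁅x, y⁆, y⁆ = -⁅y, ⁅x, y⁆⁆ := (lie_skew _ _).symm
    rw [add_lie _ r, lie_add _ _ r']
    have : ⁅p • x + q • y + s • ⁅x, y⁆, p' • x + q' • y + s' • ⁅x, y⁆⁆ =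
      (p * q' - q * p') • ⁅x, y⁆ + (p * s' - s * p') • ⁅x, ⁅x, y⁆⁆ +
      (q * s' - s * q') • ⁅y, ⁅x, y⁆⁆ := by
      simp only [add_lie, lie_add, smul_lie, lie_smul, e1, e2, e3, lie_self]
      module
    rw [this]
    abel
  rw [key, lie_add, lie_add, lie_add, lie_add, lie_smul, lie_smul, lie_smul]
  exact add_mem (add_mem (add_mem (add_mem (P.smul_mem _ (uz u)) (P.smul_mem _ (um1 u)))
    (P.smul_mem _ (um2 u))) (hIP _ (two_step_left R hr _ _))) (hIP _ (two_step_right R hr' _ _))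

theorem lcs_two_le (P : Submodule k F) (h : ∀ u v w : F, ⁅u, ⁅v, w⁆⁆ ∈ P) :
    (LieModule.lowerCentralSeries k F F 2).toSubmodule ≤ P := by
  rw [LieModule.lowerCentralSeries_succ, LieSubmodule.lieIdeal_oper_eq_linear_span',
    Submodule.span_le]
  rintro _ ⟨u, -, n, hn, rfl⟩
  have hle : (LieModule.lowerCentralSeries k F F 1).toSubmodule ≤
      P.comap (LieModule.toEnd k F F u) := by
    rw [LieModule.lowerCentralSeries_succ, LieSubmodule.lieIdeal_oper_eq_linear_span',
      Submodule.span_le]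
    rintro _ ⟨v, -, w, -, rfl⟩
    exact h u v w
  exact hle hn

theorem phi_kills (R : LieIdeal k F) (φ : F →ₗ⁅k⁆ NFour k)
    (hR : ∀ r ∈ R, φ r 0 = 0 ∧ φ r 1 = 0 ∧ φ r 2 = 0) :
    ∀ f ∈ (⁅(⁅R, (⊤ : LieIdeal k F)⁆ : LieIdeal k F), (⊤ : LieIdeal k F)⁆ :
      LieIdeal k F), φ f = 0 := by
  have hJ : ∀ f ∈ (⁅R, (⊤ : LieIdeal k F)⁆ : LieIdeal k F),
      φ f 0 = 0 ∧ φ f 1 = 0 ∧ φ f 2 = 0 ∧ φ f 3 = 0 ∧ φ f 4 = 0 := by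
    intro f hf
    rw [← LieSubmodule.mem_toSubmodule, LieSubmodule.lieIdeal_oper_eq_linear_span'] at hf
    induction hf using Submodule.span_induction with
    | mem f hf =>
      obtain ⟨r, hr, w, -, rfl⟩ := hf
      obtain ⟨h0, h1, h2⟩ := hR r hr
      simp [NFour.lie_def, NFour.br0, NFour.br1, NFour.br2, NFour.br3, NFour.br4, h0, h1, h2]
    | zero => simp [NFour.zero_apply]
    | add a b _ _ ha hb => simp [NFour.add_apply, ha, hb]
    | smul t a _ ha => simp [NFour.smul_apply, ha]
  intro f hf
  rw [← LieSubmodule.mem_toSubmodule, LieSubmodule.lieIdeal_oper_eq_linear_span'] at hf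
  induction hf using Submodule.span_induction with
  | mem f hf =>
    obtain ⟨r, hr, w, -, rfl⟩ := hf
    obtain ⟨h0, h1, h2, h3, h4⟩ := hJ r hr
    rw [LieHom.map_lie, NFour.lie_def]
    apply NFour.ext8 <;> simp [NFour.zero_apply, NFour.br0, NFour.br1, NFour.br2, NFour.br3,
      NFour.br4, NFour.br5, NFour.br6, NFour.br7, h0, h1, h2, h3, h4]
  | zero => simp
  | add a b _ _ ha hb => simp [ha, hb]
  | smul t a _ ha => simp [ha]

end Span

/-- If `L` is a Heisenberg Lie algebra `H(1)` over a field `k`, then its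
2-nilpotent multiplier `M⁽²⁾(L)` has dimension `5`. -/
theorem stmt_1 (k : Type u) [Field k] (L : Type u) [LieRing L] [LieAlgebra k L]
    (hL : IsHeisenberg k L 1)
    (X : Type u) (π : FreeLieAlgebra k X →ₗ⁅k⁆ L) (hπ : Function.Surjective π) :
    m2Rank k π = 5 := by
  obtain ⟨a, b, hc, hind, hsp⟩ := heis_gens hL
  obtain ⟨x, hx⟩ := hπ a
  obtain ⟨y, hy⟩ := hπ b
  have hker : ∀ f, f ∈ π.ker ↔ π f = 0 := fun f => LieHom.mem_ker
  have hT : ∀ u, ∃ p q s : k, ∃ r ∈ π.ker, u = p • x + q • y + s • ⁅x, y⁆ + r := by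
    intro u
    obtain ⟨p, q, s, h⟩ := hsp (π u)
    refine ⟨p, q, s, u - (p • x + q • y + s • ⁅x, y⁆), ?_, by abel⟩
    rw [hker]
    simp [hx, hy, h]
  have h1 : ⁅x, ⁅x, y⁆⁆ ∈ π.ker := by rw [hker]; simp [hx, hy, hc]
  have h2 : ⁅y, ⁅x, y⁆⁆ ∈ π.ker := by rw [hker]; simp [hx, hy, hc]
  have hspan := lcs_two_le _ (triple_mem π.ker x y hT h1 h2)
  -- the lift to the free nilpotent algebra
  have hps : Function.Surjective (NFour.proj (k := k) a b hc) := by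
    intro u
    obtain ⟨p, q, s, h⟩ := hsp u
    exact ⟨(![p, q, s, 0, 0, 0, 0, 0] : Fin 8 → k), h.symm⟩
  choose σ hσ using hps
  let φ : FreeLieAlgebra k X →ₗ⁅k⁆ NFour k :=
    FreeLieAlgebra.lift k fun t => σ (π (FreeLieAlgebra.of k t))
  have hφ : ∀ f, NFour.proj (k := k) a b hc (φ f) = π f := by
    have : (NFour.proj (k := k) a b hc).comp φ = π := by
      apply FreeLieAlgebra.hom_ext
      intro t
      simp [φ, hσ]
    intro f
    rw [← this]; rfl
  have hR : ∀ r ∈ π.ker, φ r 0 = 0 ∧ φ r 1 = 0 ∧ φ r 2 = 0 := by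
    intro r hr
    apply hind
    rw [← NFour.proj_apply a b hc, hφ]
    exact (hker r).1 hr
  have hkill := phi_kills π.ker φ hR
  have hxv : φ x 0 = 1 ∧ φ x 1 = 0 ∧ φ x 2 = 0 := by
    have h := hφ x
    rw [NFour.proj_apply, hx] at h
    have := hind (φ x 0 - 1) (φ x 1) (φ x 2) (by
      rw [sub_smul, one_smul, sub_add_eq_add_sub, sub_add_eq_add_sub, h, sub_self])
    exact ⟨sub_eq_zero.1 this.1, this.2⟩
  have hyv : φ y 0 = 0 ∧ φ y 1 = 1 ∧ φ y 2 = 0 := by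
    have h := hφ y
    rw [NFour.proj_apply, hy] at h
    have := hind (φ y 0) (φ y 1 - 1) (φ y 2) (by
      rw [sub_smul, one_smul, add_sub, sub_add_eq_add_sub, h, sub_self])
    exact ⟨this.1, sub_eq_zero.1 this.2.1, this.2.2⟩
  obtain ⟨x0, x1, x2⟩ := hxv
  obtain ⟨y0, y1, y2⟩ := hyv
  have hfive : ∀ i, NFour.top k (φ (five x y i)) = Pi.single i 1 := by
    intro i
    fin_cases i <;> funext j <;> fin_cases j <;>
    simp [five, NFour.top_apply, NFour.lie_def, NFour.br0, NFour.br1, NFour.br2, NFour.br3,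
      NFour.br4, NFour.br5, NFour.br6, NFour.br7, x0, x1, x2, y0, y1, y2]
  have hlin : ∀ g : Fin 5 → k, NFour.top k (φ (∑ i, g i • five x y i)) = g := by
    intro g
    rw [map_sum, map_sum]
    simp only [map_smul, hfive]
    funext j
    simp [Finset.sum_apply, Pi.single_apply]
  have hfmem : ∀ i, five x y i ∈ π.ker ⊓ LieModule.lowerCentralSeries k (FreeLieAlgebra k X)
      (FreeLieAlgebra k X) 2 := by
    have hl : ∀ u v w : FreeLieAlgebra k X, ⁅u, ⁅v, w⁆⁆ ∈
        LieModule.lowerCentralSeries k (FreeLieAlgebra k X) (FreeLieAlgebra k X) 2 := by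
      intro u v w
      rw [LieModule.lowerCentralSeries_succ, LieModule.lowerCentralSeries_succ]
      exact LieSubmodule.lie_mem_lie trivial (LieSubmodule.lie_mem_lie trivial trivial)
    intro i
    rw [LieSubmodule.mem_inf]
    fin_cases i
    · exact ⟨h1, hl _ _ _⟩
    · exact ⟨h2, hl _ _ _⟩
    · exact ⟨lie_mem_right k _ _ _ _ h1, hl _ _ _⟩
    · exact ⟨lie_mem_right k _ _ _ _ h1, hl _ _ _⟩
    · exact ⟨lie_mem_right k _ _ _ _ h2, hl _ _ _⟩
  unfold m2Rank subQuotRank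
  set A := (π.ker ⊓ LieModule.lowerCentralSeries k (FreeLieAlgebra k X)
    (FreeLieAlgebra k X) 2).toSubmodule with hA
  set B := (⁅(⁅π.ker, (⊤ : LieIdeal k (FreeLieAlgebra k X))⁆ : LieIdeal k (FreeLieAlgebra k X)),
      (⊤ : LieIdeal k (FreeLieAlgebra k X))⁆ : LieIdeal k (FreeLieAlgebra k X)).toSubmodule with hB
  let ψ : A →ₗ[k] (Fin 5 → k) := (NFour.top k ∘ₗ (φ : FreeLieAlgebra k X →ₗ[k] NFour k)) ∘ₗ A.subtype
  have hψ : ∀ f : A, ψ f = NFour.top k (φ f) := fun _ => rfl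
  have hsurj : Function.Surjective ψ := by
    intro g
    refine ⟨⟨∑ i, g i • five x y i, A.sum_mem fun i _ => A.smul_mem _ (hfmem i)⟩, ?_⟩
    rw [hψ]
    exact hlin g
  have hkerψ : LinearMap.ker ψ = B.comap A.subtype := by
    ext f
    rw [LinearMap.mem_ker, Submodule.mem_comap, hψ]
    constructor
    · intro h
      obtain ⟨f, hf⟩ := f
      have hf2 := hspan hf.2
      obtain ⟨s, hs, i, hi, rfl⟩ := Submodule.mem_sup.1 hf2
      obtain ⟨g, rfl⟩ := (Submodule.mem_span_range_iff_exists_fun k).1 hs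
      have hi0 : φ i = 0 := hkill i hi
      change NFour.top k (φ (_ + i)) = 0 at h
      rw [map_add, hi0, add_zero, hlin] at h
      subst h
      simpa using hi
    · intro h
      have : φ (f : FreeLieAlgebra k X) = 0 := hkill _ h
      rw [this, map_zero]
  rw [← hkerψ, (ψ.quotKerEquivOfSurjective hsurj).rank_eq]
  simp
end

section
/- Let m ≥ 2 and let L be a Heisenberg Lie algebra H(m) over a field k (so dim L = 2m+1). Then the 2-nilpotent multiplier M⁽²⁾(L) is an abelian Lie algebra of dimension (8m³ − 2m)/3. -/
open Module

universe u

section Helpers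

/-- basic index -/
def BIdx (n : ℕ) : Type := {t : Fin n × Fin n × Fin n // t.2.2 < t.2.1 ∧ t.2.2 ≤ t.1}

instance (n : ℕ) : DecidableEq (BIdx n) := by unfold BIdx; infer_instance

instance (n : ℕ) : Fintype (BIdx n) := by unfold BIdx; infer_instance

theorem sum_aux (n : ℕ) : 3 * ∑ j ∈ Finset.range n, (j * (j + 1)) + n = n ^ 3 := by
  induction n with
  | zero => simp
  | succ n ih => rw [Finset.sum_range_succ]; nlinarith

theorem card_BIdx (n : ℕ) : 3 * Fintype.card (BIdx n) + n = n ^ 3 := by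
  have e : BIdx n ≃ Σ j : Fin n, (Finset.Ici j) × (Finset.Ioi j) :=
    { toFun := fun t => ⟨t.1.2.2, ⟨t.1.1, by simpa using t.2.2⟩, ⟨t.1.2.1, by simpa using t.2.1⟩⟩
      invFun := fun s => ⟨(s.2.1.1, s.2.2.1, s.1),
        Finset.mem_Ioi.1 s.2.2.2, Finset.mem_Ici.1 s.2.1.2⟩
      left_inv := fun t => rfl
      right_inv := fun s => rfl }
  rw [Fintype.card_congr e, Fintype.card_sigma]
  simp only [Fintype.card_prod, Fintype.card_coe, Fin.card_Ici, Fin.card_Ioi]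
  rw [Fin.sum_univ_eq_sum_range (fun j => (n - j) * (n - 1 - j)) n, ← Finset.sum_range_reflect]
  conv_rhs => rw [← sum_aux n]
  congr 2
  apply Finset.sum_congr rfl
  intro j hj
  have := Finset.mem_range.1 hj
  have h1 : n - (n - 1 - j) = j + 1 := by omega
  have h2 : n - 1 - (n - 1 - j) = j := by omega
  rw [h1, h2, mul_comm]

/-- strictly upper triangular 4x4 with prescribed superdiagonal -/
def SUT {k : Type*} [Field k] (M : Matrix (Fin 4) (Fin 4) k) (a b c : k) : Prop :=
  (∀ i j : Fin 4, j ≤ i → M i j = 0) ∧ M 0 1 = a ∧ M 1 2 = b ∧ M 2 3 = c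

/-- superdiagonal matrix -/
def supd {k : Type*} [Field k] (a b c : k) : Matrix (Fin 4) (Fin 4) k :=
  !![0, a, 0, 0; 0, 0, b, 0; 0, 0, 0, c; 0, 0, 0, 0]

theorem SUT_supd {k : Type*} [Field k] (a b c : k) : SUT (supd a b c) a b c := by
  refine ⟨?_, rfl, rfl, rfl⟩
  intro i j h
  fin_cases i <;> fin_cases j <;> first | rfl | (exact absurd h (by decide))

theorem SUT_lie {k : Type*} [Field k] {M N : Matrix (Fin 4) (Fin 4) k} {a b c a' b' c' : k}
    (hM : SUT M a b c) (hN : SUT N a' b' c') :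
    SUT ⁅M, N⁆ 0 0 0 ∧ ⁅M, N⁆ 0 2 = a * b' - a' * b ∧ ⁅M, N⁆ 1 3 = b * c' - b' * c := by
  obtain ⟨hM, rfl, rfl, rfl⟩ := hM
  obtain ⟨hN, rfl, rfl, rfl⟩ := hN
  have e : ∀ i j, ⁅M, N⁆ i j = ∑ l, M i l * N l j - ∑ l, N i l * M l j := by
    intro i j; rw [Ring.lie_def, Matrix.sub_apply, Matrix.mul_apply, Matrix.mul_apply]
  have z : ∀ P : Matrix (Fin 4) (Fin 4) k, (∀ i j : Fin 4, j ≤ i → P i j = 0) →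
    P 0 0 = 0 ∧ P 1 0 = 0 ∧ P 1 1 = 0 ∧ P 2 0 = 0 ∧ P 2 1 = 0 ∧ P 2 2 = 0 ∧
    P 3 0 = 0 ∧ P 3 1 = 0 ∧ P 3 2 = 0 ∧ P 3 3 = 0 := by
    intro P hP
    refine ⟨?_, ?_, ?_, ?_, ?_, ?_, ?_, ?_, ?_, ?_⟩ <;> exact hP _ _ (by decide)
  obtain ⟨m1, m2, m3, m4, m5, m6, m7, m8, m9, m10⟩ := z M hM
  obtain ⟨n1, n2, n3, n4, n5, n6, n7, n8, n9, n10⟩ := z N hN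
  refine ⟨⟨?_, ?_, ?_, ?_⟩, ?_, ?_⟩
  · intro i j h
    rw [e, Fin.sum_univ_four, Fin.sum_univ_four]
    fin_cases i <;> fin_cases j <;> first
      | (exact absurd h (by decide))
      | simp [m1, m2, m3, m4, m5, m6, m7, m8, m9, m10, n1, n2, n3, n4, n5, n6, n7, n8, n9, n10]
  all_goals
    rw [e, Fin.sum_univ_four, Fin.sum_univ_four]
    simp [m1, m2, m3, m4, m5, m6, m7, m8, m9, m10, n1, n2, n3, n4, n5, n6, n7, n8, n9, n10]

theorem SUT_lie03 {k : Type*} [Field k] {M N : Matrix (Fin 4) (Fin 4) k} {a b c : k}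
    (hM : SUT M a b c) (hN : SUT N 0 0 0) :
    ⁅M, N⁆ 0 3 = a * N 1 3 - N 0 2 * c := by
  obtain ⟨hM, rfl, rfl, rfl⟩ := hM
  obtain ⟨hN, n1, n2, n3⟩ := hN
  rw [Ring.lie_def, Matrix.sub_apply, Matrix.mul_apply, Matrix.mul_apply, Fin.sum_univ_four,
    Fin.sum_univ_four, hM 0 0 (by decide), hN 0 0 (by decide), hM 3 3 (by decide),
    hN 3 3 (by decide), n1, n3]
  ring

end Helpers

section Free
attribute [local instance 100] LieRing.ofAssociativeRing

variable {k : Type u} [Field k] {X : Type u}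

theorem free_induction {p : FreeLieAlgebra k X → Prop}
    (h0 : p 0) (hof : ∀ x, p (FreeLieAlgebra.of k x)) (hadd : ∀ x y, p x → p y → p (x + y))
    (hsmul : ∀ (c : k) x, p x → p (c • x)) (hlie : ∀ x y, p x → p y → p ⁅x, y⁆) (x) : p x := by
  let S : LieSubalgebra k (FreeLieAlgebra k X) :=
    { carrier := {x | p x}
      add_mem' := fun {a b} ha hb => hadd a b ha hb
      zero_mem' := h0
      smul_mem' := fun c x hx => hsmul c x hx
      lie_mem' := fun {a b} ha hb => hlie a b ha hb }
  have h : S.incl.comp (FreeLieAlgebra.lift k (fun x => (⟨FreeLieAlgebra.of k x, hof x⟩ : S)))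
      = LieHom.id := by
    ext x; simp
  have := congrArg (fun f => f x) h
  simp only [LieHom.comp_apply, LieHom.id_apply] at this
  rw [← this]
  exact (FreeLieAlgebra.lift k (fun x => (⟨FreeLieAlgebra.of k x, hof x⟩ : S)) x).2

/-- matrix rep -/
noncomputable def rep (a b c : FreeLieAlgebra k X →ₗ[k] k) :
    FreeLieAlgebra k X →ₗ⁅k⁆ Matrix (Fin 4) (Fin 4) k :=
  FreeLieAlgebra.lift k (fun x => supd (a (.of k x)) (b (.of k x)) (c (.of k x)))

theorem SUT_rep (a b c : FreeLieAlgebra k X →ₗ[k] k) (ha : ∀ x y : FreeLieAlgebra k X, a ⁅x, y⁆ = 0)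
    (hb : ∀ x y : FreeLieAlgebra k X, b ⁅x, y⁆ = 0) (hc : ∀ x y : FreeLieAlgebra k X, c ⁅x, y⁆ = 0) (x : FreeLieAlgebra k X) :
    SUT (rep a b c x) (a x) (b x) (c x) := by
  induction x using free_induction with
  | h0 => simp [SUT]
  | hof x => unfold rep; rw [FreeLieAlgebra.lift_of_apply]; exact SUT_supd _ _ _
  | hadd x y hx hy =>
    obtain ⟨h1, h2, h3, h4⟩ := hx
    obtain ⟨h1', h2', h3', h4'⟩ := hy
    simp only [map_add]
    refine ⟨fun i j h => ?_, ?_, ?_, ?_⟩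
    · rw [Matrix.add_apply, h1 i j h, h1' i j h, add_zero]
    all_goals simp [*]
  | hsmul r x hx =>
    obtain ⟨h1, h2, h3, h4⟩ := hx
    simp only [map_smul]
    refine ⟨fun i j h => ?_, ?_, ?_, ?_⟩
    · rw [Matrix.smul_apply, h1 i j h, smul_zero]
    all_goals simp [*]
  | hlie x y hx hy =>
    rw [ha, hb, hc, LieHom.map_lie]
    exact (SUT_lie hx hy).1

/-- the functional -/
noncomputable def phi (a b c : FreeLieAlgebra k X →ₗ[k] k) : FreeLieAlgebra k X →ₗ[k] k :=
  (Matrix.entryLinearMap k k (0 : Fin 4) (3 : Fin 4)).comp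
    ((rep a b c : FreeLieAlgebra k X →ₗ⁅k⁆ Matrix (Fin 4) (Fin 4) k) :
      FreeLieAlgebra k X →ₗ[k] Matrix (Fin 4) (Fin 4) k)

theorem phi_lie (a b c : FreeLieAlgebra k X →ₗ[k] k) (ha : ∀ x y : FreeLieAlgebra k X, a ⁅x, y⁆ = 0)
    (hb : ∀ x y : FreeLieAlgebra k X, b ⁅x, y⁆ = 0) (hc : ∀ x y : FreeLieAlgebra k X, c ⁅x, y⁆ = 0) (x y z : FreeLieAlgebra k X) :
    phi a b c ⁅x, ⁅y, z⁆⁆ =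
      a x * (b y * c z - b z * c y) - (a y * b z - a z * b y) * c x := by
  have h := SUT_rep a b c ha hb hc
  have h1 := SUT_lie (h y) (h z)
  have h2 := SUT_lie03 (h x) h1.1
  rw [h1.2.1, h1.2.2] at h2
  simpa [phi] using h2

theorem phi_lie' (a b c : FreeLieAlgebra k X →ₗ[k] k) (ha : ∀ x y : FreeLieAlgebra k X, a ⁅x, y⁆ = 0)
    (hb : ∀ x y : FreeLieAlgebra k X, b ⁅x, y⁆ = 0) (hc : ∀ x y : FreeLieAlgebra k X, c ⁅x, y⁆ = 0) (x y z : FreeLieAlgebra k X) :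
    phi a b c ⁅⁅x, y⁆, z⁆ =
      -(a z * (b x * c y - b y * c x) - (a x * b y - a y * b x) * c z) := by
  rw [← phi_lie a b c ha hb hc, ← map_neg, lie_skew]

end Free

section Heis
variable {k : Type u} [Field k] {L : Type u} [LieRing L] [LieAlgebra k L] {m : ℕ}

theorem heis_fd (hL : IsHeisenberg k L m) : FiniteDimensional k L :=
  Module.finite_of_finrank_pos (by rw [hL.1]; omega)

theorem heis_lie_mem (hL : IsHeisenberg k L m) (x y : L) : ⁅x, y⁆ ∈ LieAlgebra.center k L := by
  rw [← hL.2.1, LieModule.lowerCentralSeries_succ]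
  exact LieSubmodule.lie_mem_lie (LieSubmodule.mem_top _) (by simp)

theorem mem_center {z : L} : z ∈ LieAlgebra.center k L ↔ ∀ x : L, ⁅x, z⁆ = 0 :=
  LieModule.mem_maxTrivSubmodule k L L z

theorem heis_exists (hm : 2 ≤ m) (hL : IsHeisenberg k L m) (b : L) :
    ∃ x y : L, ⁅x, b⁆ = 0 ∧ ⁅y, b⁆ = 0 ∧ ⁅x, y⁆ ≠ 0 := by
  by_contra! hcon
  have := heis_fd hL
  let Z : Submodule k L := (LieAlgebra.center k L).toSubmodule
  have hZ : Module.finrank k Z = 1 := hL.2.2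
  have key : ∀ e : L, 2 * m ≤ Module.finrank k (LinearMap.ker (LieAlgebra.ad k L e : L →ₗ[k] L)) := by
    intro e
    have h1 := LinearMap.finrank_range_add_finrank_ker (LieAlgebra.ad k L e : L →ₗ[k] L)
    have h2 : LinearMap.range (LieAlgebra.ad k L e : L →ₗ[k] L) ≤ Z := by
      rintro _ ⟨y, rfl⟩
      exact heis_lie_mem hL e y
    have h3 := Submodule.finrank_mono h2
    rw [hL.1] at h1
    omega
  let C := LinearMap.ker (LieAlgebra.ad k L b : L →ₗ[k] L)
  have hC : ∀ x, x ∈ C ↔ ⁅x, b⁆ = 0 := by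
    intro x
    rw [LinearMap.mem_ker, LieAlgebra.ad_apply, ← lie_skew, neg_eq_zero]
  have hCC : ∀ x ∈ C, ∀ y ∈ C, ⁅x, y⁆ = 0 := fun x hx y hy =>
    hcon x y ((hC x).1 hx) ((hC y).1 hy)
  obtain ⟨e, he⟩ : ∃ e, C ⊔ Submodule.span k {e} = ⊤ := by
    by_cases h : C = ⊤
    · exact ⟨0, by simp [h]⟩
    · obtain ⟨e, he⟩ : ∃ e, e ∉ C := by
        by_contra! h'
        exact h (by ext; simp [h'])
      refine ⟨e, Submodule.eq_top_of_finrank_eq ?_⟩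
      have hlt : C < C ⊔ Submodule.span k {e} := by
        refine lt_of_le_of_ne le_sup_left fun h' => he ?_
        rw [h']
        exact Submodule.mem_sup_right (Submodule.mem_span_singleton_self e)
      have h1 := Submodule.finrank_lt_finrank_of_lt hlt
      have h2 := Submodule.finrank_le (C ⊔ Submodule.span k {e})
      have h3 := key b
      rw [hL.1] at *
      change 2 * m ≤ Module.finrank k C at h3
      omega
  let D := LinearMap.ker (LieAlgebra.ad k L e : L →ₗ[k] L)
  have hD : C ⊓ D ≤ Z := by
    rintro x ⟨hx, hx'⟩
    change x ∈ LieAlgebra.center k L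
    rw [mem_center]
    intro y
    have hy : y ∈ C ⊔ Submodule.span k {e} := by rw [he]; trivial
    obtain ⟨c, hc, d, hd, rfl⟩ := Submodule.mem_sup.1 hy
    obtain ⟨r, rfl⟩ := Submodule.mem_span_singleton.1 hd
    have : ⁅e, x⁆ = 0 := hx'
    rw [add_lie, smul_lie, this, hCC c hc x hx]; simp
  have h1 := Submodule.finrank_mono hD
  have h2 := Submodule.finrank_sup_add_finrank_inf_eq C D
  have h3 := Submodule.finrank_le (C ⊔ D)
  have h4 : 2 * m ≤ Module.finrank k C := key b
  have h5 : 2 * m ≤ Module.finrank k D := key e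
  rw [hL.1] at h3
  omega

theorem heis_basis (hL : IsHeisenberg k L m) :
    ∃ (v : Fin (2 * m) → L) (α : Fin (2 * m) → L →ₗ[k] k),
      (∀ i j, α i (v j) = if i = j then 1 else 0) ∧
      (∀ i, ∀ z ∈ LieAlgebra.center k L, α i z = 0) ∧
      (∀ x, x - ∑ i, α i x • v i ∈ LieAlgebra.center k L) := by
  have := heis_fd hL
  let Z : Submodule k L := (LieAlgebra.center k L).toSubmodule
  have hZ : Module.finrank k Z = 1 := hL.2.2
  have hq : Module.finrank k (L ⧸ Z) = 2 * m := by
    have := Submodule.finrank_quotient_add_finrank Z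
    rw [hL.1] at this
    omega
  let b := Module.finBasisOfFinrankEq k (L ⧸ Z) hq
  choose v hv using fun i => Z.mkQ_surjective (b i)
  refine ⟨v, fun i => (b.coord i).comp Z.mkQ, ?_, ?_, ?_⟩
  · intro i j
    simp only [LinearMap.comp_apply, hv, Basis.coord_apply, Basis.repr_self]
    rw [Finsupp.single_apply]
    simp [eq_comm]
  · intro i z hz
    have : Z.mkQ z = 0 := (Submodule.Quotient.mk_eq_zero Z).2 hz
    rw [LinearMap.comp_apply, this, map_zero]
  · intro x
    change _ ∈ Z
    rw [← Submodule.Quotient.mk_eq_zero, ← Submodule.mkQ_apply, map_sub, map_sum]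
    simp only [map_smul, hv]
    rw [sub_eq_zero]
    exact (b.sum_repr (Z.mkQ x)).symm

end Heis

section Main
variable {k : Type u} [Field k] {L : Type u} [LieRing L] [LieAlgebra k L] {m : ℕ}
  {X : Type u}

/-- `[[R,F],F]` -/
noncomputable abbrev RFF (π : FreeLieAlgebra k X →ₗ⁅k⁆ L) : LieIdeal k (FreeLieAlgebra k X) :=
  ⁅(⁅π.ker, (⊤ : LieIdeal k (FreeLieAlgebra k X))⁆ : LieIdeal k (FreeLieAlgebra k X)),
      (⊤ : LieIdeal k (FreeLieAlgebra k X))⁆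

/-- `F³` -/
noncomputable abbrev F3 (k : Type u) [Field k] (X : Type u) : LieIdeal k (FreeLieAlgebra k X) :=
  LieModule.lowerCentralSeries k (FreeLieAlgebra k X) (FreeLieAlgebra k X) 2

theorem lie_mem_RF (π : FreeLieAlgebra k X →ₗ⁅k⁆ L) {r : FreeLieAlgebra k X} (hr : π r = 0) (x) :
    ⁅r, x⁆ ∈ (⁅π.ker, (⊤ : LieIdeal k (FreeLieAlgebra k X))⁆ : LieIdeal k (FreeLieAlgebra k X)) :=
  LieSubmodule.lie_mem_lie ((LieHom.mem_ker ).2 hr) (LieSubmodule.mem_top _)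

theorem lie_mem_F3 (x y z : FreeLieAlgebra k X) : ⁅x, ⁅y, z⁆⁆ ∈ F3 k X := by
  unfold F3
  rw [LieModule.lowerCentralSeries_succ, LieModule.lowerCentralSeries_succ]
  exact LieSubmodule.lie_mem_lie (LieSubmodule.mem_top _)
    (LieSubmodule.lie_mem_lie (LieSubmodule.mem_top _) (by simp))

theorem F3_le (S : Submodule k (FreeLieAlgebra k X))
    (h : ∀ x y z : FreeLieAlgebra k X, ⁅x, ⁅y, z⁆⁆ ∈ S) : (F3 k X).toSubmodule ≤ S := by
  unfold F3
  rw [LieModule.lowerCentralSeries_succ, LieSubmodule.lieIdeal_oper_eq_linear_span',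
    Submodule.span_le]
  rintro _ ⟨x, -, w, hw, rfl⟩
  rw [LieModule.lowerCentralSeries_succ, ← LieSubmodule.mem_toSubmodule,
    LieSubmodule.lieIdeal_oper_eq_linear_span'] at hw
  have : Submodule.span k {x | ∃ a ∈ (⊤ : LieIdeal k (FreeLieAlgebra k X)), ∃ n ∈
      LieModule.lowerCentralSeries k (FreeLieAlgebra k X) (FreeLieAlgebra k X) 0, ⁅a, n⁆ = x} ≤
      S.comap (LieAlgebra.ad k _ x : FreeLieAlgebra k X →ₗ[k] FreeLieAlgebra k X) := by
    rw [Submodule.span_le]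
    rintro _ ⟨y, -, z, -, rfl⟩
    exact h x y z
  exact this hw

theorem RFF_le (π : FreeLieAlgebra k X →ₗ⁅k⁆ L) (S : Submodule k (FreeLieAlgebra k X))
    (h : ∀ x y z : FreeLieAlgebra k X, π x = 0 → ⁅⁅x, y⁆, z⁆ ∈ S) : (RFF π).toSubmodule ≤ S := by
  unfold RFF
  rw [LieSubmodule.lieIdeal_oper_eq_linear_span', Submodule.span_le]
  rintro _ ⟨w, hw, z, -, rfl⟩
  rw [← LieSubmodule.mem_toSubmodule, LieSubmodule.lieIdeal_oper_eq_linear_span'] at hw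
  have : Submodule.span k {x | ∃ a ∈ π.ker, ∃ n ∈ (⊤ : LieIdeal k (FreeLieAlgebra k X)),
      ⁅a, n⁆ = x} ≤
      S.comap (LieAlgebra.ad k _ z : FreeLieAlgebra k X →ₗ[k] FreeLieAlgebra k X) := by
    rw [Submodule.span_le]
    rintro _ ⟨x, hx, y, -, rfl⟩
    have := h x y z (LieHom.mem_ker.1 hx)
    rw [← lie_skew] at this
    have h3 : ⁅z, ⁅x, y⁆⁆ ∈ S := neg_mem_iff.1 this
    exact h3
  have h2 : ⁅z, w⁆ ∈ S := this hw
  rw [← lie_skew]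
  exact S.neg_mem h2

theorem lie_mem_RF_of_center (hm : 2 ≤ m) (hL : IsHeisenberg k L m)
    (π : FreeLieAlgebra k X →ₗ⁅k⁆ L) (hπ : Function.Surjective π) {d : FreeLieAlgebra k X}
    (hd : π d ∈ LieAlgebra.center k L) (y : FreeLieAlgebra k X) :
    ⁅y, d⁆ ∈ (⁅π.ker, (⊤ : LieIdeal k (FreeLieAlgebra k X))⁆ :
      LieIdeal k (FreeLieAlgebra k X)) := by
  obtain ⟨p', q', hp, hq, hne⟩ := heis_exists hm hL (π y)
  obtain ⟨p, rfl⟩ := hπ p'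
  obtain ⟨q, rfl⟩ := hπ q'
  obtain ⟨c, hc⟩ : ∃ c : k, c • ⁅π p, π q⁆ = π d := by
    have h := (finrank_eq_one_iff_of_nonzero'
      (⟨⁅π p, π q⁆, heis_lie_mem hL _ _⟩ : LieAlgebra.center k L)
      (fun h => hne (congrArg Subtype.val h))).1 hL.2.2 ⟨π d, hd⟩
    obtain ⟨c, hc⟩ := h
    exact ⟨c, congrArg Subtype.val hc⟩
  have e : ⁅y, d⁆ = c • (⁅⁅y, p⁆, q⁆ - ⁅⁅y, q⁆, p⁆) - ⁅d - c • ⁅p, q⁆, y⁆ := by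
    have h1 : ⁅⁅y, p⁆, q⁆ - ⁅⁅y, q⁆, p⁆ = ⁅y, ⁅p, q⁆⁆ := by
      rw [leibniz_lie y p q, ← lie_skew p ⁅y, q⁆]; abel
    rw [h1, ← lie_skew (d - c • ⁅p, q⁆) y, lie_sub, lie_smul]; abel
  rw [e]
  have hp' : π ⁅y, p⁆ = 0 := by rw [LieHom.map_lie, ← lie_skew, hp, neg_zero]
  have hq' : π ⁅y, q⁆ = 0 := by rw [LieHom.map_lie, ← lie_skew, hq, neg_zero]
  have hr : π (d - c • ⁅p, q⁆) = 0 := by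
    rw [map_sub, map_smul, LieHom.map_lie, hc, sub_self]
  exact sub_mem (Submodule.smul_mem _ c (sub_mem (lie_mem_RF π hp' q) (lie_mem_RF π hq' p)))
    (lie_mem_RF π hr y)

/-- the pairing functionals -/
noncomputable def psi {n : ℕ} (β : Fin n → FreeLieAlgebra k X →ₗ[k] k) (t : BIdx n) :
    FreeLieAlgebra k X →ₗ[k] k :=
  if t.1.1 = t.1.2.2 then - phi (β t.1.2.1) (β t.1.2.2) (β t.1.1)
  else phi (β t.1.2.2) (β t.1.2.1) (β t.1.1)

theorem psi_basic {n : ℕ} (β : Fin n → FreeLieAlgebra k X →ₗ[k] k)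
    (hβ : ∀ i, ∀ x y : FreeLieAlgebra k X, β i ⁅x, y⁆ = 0)
    (w : Fin n → FreeLieAlgebra k X) (hw : ∀ i j, β i (w j) = if i = j then 1 else 0)
    (s t : BIdx n) :
    psi β s ⁅w t.1.1, ⁅w t.1.2.1, w t.1.2.2⁆⁆ = if s = t then 1 else 0 := by
  obtain ⟨⟨c, a, b⟩, h1, h2⟩ := s
  obtain ⟨⟨c', a', b'⟩, h1', h2'⟩ := t
  have e : ((⟨(c, a, b), h1, h2⟩ : BIdx n) = ⟨(c', a', b'), h1', h2'⟩) ↔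
      (c = c' ∧ a = a' ∧ b = b') := by
    constructor
    · intro h
      have := congrArg Subtype.val h
      simpa using this
    · rintro ⟨rfl, rfl, rfl⟩; rfl
  simp only [e]
  dsimp only at h1 h2 h1' h2'
  unfold psi
  dsimp only
  split_ifs with hcb
  all_goals
    simp only [LinearMap.neg_apply, phi_lie _ _ _ (hβ _) (hβ _) (hβ _), hw]
    clear e hβ hw
    grind

theorem main_rank (hm : 2 ≤ m) (hL : IsHeisenberg k L m)
    (π : FreeLieAlgebra k X →ₗ⁅k⁆ L) (hπ : Function.Surjective π) :
    m2Rank k π = (Fintype.card (BIdx (2 * m)) : ℕ) := by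
  have hA : π.ker ⊓ LieModule.lowerCentralSeries k (FreeLieAlgebra k X) (FreeLieAlgebra k X) 2 =
      F3 k X := by
    refine inf_eq_right.2 ?_
    refine F3_le π.ker.toSubmodule ?_
    intro x y z
    change _ ∈ π.ker
    rw [LieHom.mem_ker, LieHom.map_lie, LieHom.map_lie]
    exact mem_center.1 (heis_lie_mem hL _ _) _
  unfold m2Rank subQuotRank
  rw [hA]
  change Module.rank k ((F3 k X).toSubmodule ⧸
    (RFF π).toSubmodule.comap (F3 k X).toSubmodule.subtype) = _
  obtain ⟨v, α, hαv, hαz, hx⟩ := heis_basis hL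
  choose w hw using fun i => hπ (v i)
  let β : Fin (2 * m) → FreeLieAlgebra k X →ₗ[k] k := fun i =>
    (α i).comp (π : FreeLieAlgebra k X →ₗ[k] L)
  have hβl : ∀ i, ∀ x y : FreeLieAlgebra k X, β i ⁅x, y⁆ = 0 := by
    intro i x y
    change α i (π ⁅x, y⁆) = 0
    rw [LieHom.map_lie]
    exact hαz i _ (heis_lie_mem hL _ _)
  have hβw : ∀ i j, β i (w j) = if i = j then 1 else 0 := by
    intro i j
    change α i (π (w j)) = _
    rw [hw, hαv]
  have hβr : ∀ i x, π x = 0 → β i x = 0 := by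
    intro i x h
    change α i (π x) = 0
    rw [h, map_zero]
  have hdec : ∀ x, π (x - ∑ i, β i x • w i) ∈ LieAlgebra.center k L := by
    intro x
    rw [map_sub, map_sum]
    simp only [map_smul, hw]
    exact hx (π x)
  -- the generators
  let T : BIdx (2 * m) → FreeLieAlgebra k X := fun t => ⁅w t.1.1, ⁅w t.1.2.1, w t.1.2.2⁆⁆
  let Q := (RFF π).toSubmodule.comap (F3 k X).toSubmodule.subtype
  let B : BIdx (2 * m) → ((F3 k X).toSubmodule ⧸ Q) := fun t =>
    Q.mkQ ⟨T t, lie_mem_F3 _ _ _⟩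
  have hphi : ∀ i j l, (RFF π).toSubmodule ≤ LinearMap.ker (phi (β i) (β j) (β l)) := by
    intro i j l
    refine RFF_le π _ fun x y z h => ?_
    rw [LinearMap.mem_ker, phi_lie' _ _ _ (hβl i) (hβl j) (hβl l), hβr i x h, hβr j x h,
      hβr l x h]
    ring
  have hpsi : ∀ t, (RFF π).toSubmodule ≤ LinearMap.ker (psi β t) := by
    intro t x hx
    unfold psi
    rw [LinearMap.mem_ker]
    split_ifs
    · rw [LinearMap.neg_apply, LinearMap.mem_ker.1 (hphi _ _ _ hx), neg_zero]
    · exact hphi _ _ _ hx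
  have hli : LinearIndependent k B := by
    rw [Fintype.linearIndependent_iff]
    intro g hg s
    have h1 : Q.mkQ (∑ t, g t • ⟨T t, lie_mem_F3 _ _ _⟩) = 0 := by
      rw [map_sum]
      simpa only [map_smul] using hg
    rw [Submodule.mkQ_apply, Submodule.Quotient.mk_eq_zero] at h1
    have h2 := hpsi s h1
    rw [LinearMap.mem_ker] at h2
    simp only [map_sum, map_smul, Submodule.subtype_apply] at h2
    have h3 : ∀ t, psi β s (T t) = if s = t then 1 else 0 := psi_basic β hβl w hβw s
    simpa [h3] using h2
  -- spanning
  let S : Submodule k (FreeLieAlgebra k X) := Submodule.span k (Set.range T) ⊔ (RFF π).toSubmodule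
  have hRS : ∀ x, x ∈ RFF π → x ∈ S := fun x hx => Submodule.mem_sup_right hx
  have hlin : ∀ f : FreeLieAlgebra k X →ₗ[k] FreeLieAlgebra k X,
      (∀ d, π d ∈ LieAlgebra.center k L → f d ∈ RFF π) → (∀ i, f (w i) ∈ S) → ∀ x, f x ∈ S := by
    intro f hd hf x
    have e : x = (x - ∑ i, β i x • w i) + ∑ i, β i x • w i := by abel
    rw [e, map_add, map_sum]
    refine S.add_mem (hRS _ (hd _ (hdec x))) (S.sum_mem fun i _ => ?_)
    rw [map_smul]
    exact S.smul_mem _ (hf i)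
  have c1 : ∀ d, π d ∈ LieAlgebra.center k L → ∀ x y : FreeLieAlgebra k X, ⁅x, ⁅y, d⁆⁆ ∈ RFF π := by
    intro d hd x y
    have := lie_mem_RF_of_center hm hL π hπ hd y
    have h2 : ⁅⁅y, d⁆, x⁆ ∈ RFF π := LieSubmodule.lie_mem_lie this (LieSubmodule.mem_top _)
    rw [← lie_skew]
    exact neg_mem h2
  have c2 : ∀ d, π d ∈ LieAlgebra.center k L → ∀ x y : FreeLieAlgebra k X, ⁅x, ⁅d, y⁆⁆ ∈ RFF π := by
    intro d hd x y
    rw [← lie_skew d y, lie_neg]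
    exact neg_mem (c1 d hd x y)
  have c3 : ∀ d, π d ∈ LieAlgebra.center k L → ∀ x y : FreeLieAlgebra k X, ⁅d, ⁅x, y⁆⁆ ∈ RFF π := by
    intro d hd x y
    rw [leibniz_lie, ← lie_skew ⁅d, x⁆ y]
    exact add_mem (neg_mem (c2 d hd y x)) (c2 d hd x y)
  have hbas : ∀ a b c, b < a → b ≤ c → ⁅w c, ⁅w a, w b⁆⁆ ∈ S := fun a b c h1 h2 =>
    Submodule.mem_sup_left (Submodule.subset_span ⟨⟨(c, a, b), h1, h2⟩, rfl⟩)
  have hbas2 : ∀ a b c, b < a → ⁅w c, ⁅w a, w b⁆⁆ ∈ S := by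
    intro a b c h1
    rcases le_or_gt b c with h2 | h2
    · exact hbas a b c h1 h2
    · have e : ⁅w c, ⁅w a, w b⁆⁆ = ⁅w b, ⁅w a, w c⁆⁆ - ⁅w a, ⁅w b, w c⁆⁆ := by
        rw [leibniz_lie (w c), ← lie_skew ⁅w c, w a⁆ (w b), ← lie_skew (w a) (w c),
          ← lie_skew (w b) (w c), lie_neg, lie_neg]
        abel
      rw [e]
      exact S.sub_mem (hbas a c b (h2.trans h1) h2.le) (hbas b c a h2 (h2.trans h1).le)
  have hw3 : ∀ a b c, ⁅w c, ⁅w a, w b⁆⁆ ∈ S := by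
    intro a b c
    rcases lt_trichotomy b a with h | h | h
    · exact hbas2 a b c h
    · subst h; simp
    · rw [← lie_skew (w a), lie_neg]
      exact S.neg_mem (hbas2 b a c h)
  have s1 : ∀ c a z, ⁅w c, ⁅w a, z⁆⁆ ∈ S := fun c a =>
    hlin ((LieAlgebra.ad k _ (w c)).comp (LieAlgebra.ad k _ (w a)))
      (fun d hd => c1 d hd _ _) (fun b => hw3 a b c)
  have s2 : ∀ (c) (y z : FreeLieAlgebra k X), ⁅w c, ⁅y, z⁆⁆ ∈ S := by
    intro c y z
    have := hlin ((LieAlgebra.ad k _ (w c)).comp (LieAlgebra.ad k _ z))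
      (fun d hd => c1 d hd _ _)
      (fun a => by
        change ⁅w c, ⁅z, w a⁆⁆ ∈ S
        rw [← lie_skew z (w a), lie_neg]
        exact S.neg_mem (s1 c a z)) y
    change ⁅w c, ⁅z, y⁆⁆ ∈ S at this
    rw [← lie_skew y z, lie_neg]
    exact S.neg_mem this
  have s3 : ∀ x y z : FreeLieAlgebra k X, ⁅x, ⁅y, z⁆⁆ ∈ S := by
    intro x y z
    have := hlin (LieAlgebra.ad k _ ⁅y, z⁆)
      (fun d hd => by
        change ⁅⁅y, z⁆, d⁆ ∈ RFF π
        rw [← lie_skew]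
        exact neg_mem (c3 d hd _ _))
      (fun a => by
        change ⁅⁅y, z⁆, w a⁆ ∈ S
        rw [← lie_skew]
        exact S.neg_mem (s2 _ _ _)) x
    change ⁅⁅y, z⁆, x⁆ ∈ S at this
    rw [← lie_skew]
    exact S.neg_mem this
  have hS := F3_le S s3
  have hsp : ⊤ ≤ Submodule.span k (Set.range B) := by
    rintro q -
    obtain ⟨⟨f, hf⟩, rfl⟩ := Q.mkQ_surjective q
    obtain ⟨g, hg, r, hr, e⟩ := Submodule.mem_sup.1 (hS hf)
    obtain ⟨c, rfl⟩ := (Submodule.mem_span_range_iff_exists_fun k).1 hg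
    have : Q.mkQ ⟨f, hf⟩ = ∑ t, c t • B t := by
      have h1 : ∑ t, c t • B t = Q.mkQ (∑ t, c t • ⟨T t, lie_mem_F3 _ _ _⟩) := by
        rw [map_sum]; simp only [map_smul]; rfl
      rw [h1, ← sub_eq_zero, ← map_sub, Submodule.mkQ_apply, Submodule.Quotient.mk_eq_zero]
      change (F3 k X).toSubmodule.subtype _ ∈ (RFF π).toSubmodule
      rw [map_sub, map_sum]
      simp only [map_smul, Submodule.subtype_apply]
      rw [← e, add_sub_cancel_left]
      exact hr
    rw [this]
    exact Submodule.sum_mem _ fun t _ => Submodule.smul_mem _ _ (Submodule.subset_span ⟨t, rfl⟩)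
  rw [rank_eq_card_basis (Basis.mk hli hsp)]

end Main

/-- If `m ≥ 2` and `L` is a Heisenberg Lie algebra `H(m)` over a field `k`, then
its 2-nilpotent multiplier `M⁽²⁾(L)` has dimension `(8m³ - 2m)/3`. -/
theorem stmt_2 (k : Type u) [Field k] (L : Type u) [LieRing L] [LieAlgebra k L]
    (m : ℕ) (hm : 2 ≤ m) (hL : IsHeisenberg k L m)
    (X : Type u) (π : FreeLieAlgebra k X →ₗ⁅k⁆ L) (hπ : Function.Surjective π) :
    m2Rank k π = ((8 * m ^ 3 - 2 * m) / 3 : ℕ) := by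
  rw [main_rank hm hL π hπ]
  have h := card_BIdx (2 * m)
  congr 1
  have h2 : (2 * m) ^ 3 = 8 * m ^ 3 := by ring
  omega
end

section
/- Let L be a Lie algebra over a field k with free presentation π : F ↠ L with kernel R, and let π̄ : F/[[R,F],F] ↠ L be the induced epimorphism. Then L is 2-capable if and only if π̄(Z₂(F/[[R,F],F])) = 0, i.e. if and only if Z₂(F/[[R,F],F]) ⊆ R/[[R,F],F]. -/
open Module

universe u

lemma mem_Z2 {k H : Type u} [Field k] [LieRing H] [LieAlgebra k H] (x : H) :
    x ∈ LieSubmodule.ucs 2 (⊥ : LieIdeal k H) ↔ ∀ a b : H, ⁅b, ⁅a, x⁆⁆ = 0 := by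
  rw [LieSubmodule.ucs_succ, LieSubmodule.mem_normalizer]
  refine forall_congr' fun a => ?_
  rw [LieSubmodule.ucs_succ, LieSubmodule.mem_normalizer]
  simp

lemma equiv_of_ker {k F A B : Type u} [Field k] [LieRing F] [LieAlgebra k F]
    [LieRing A] [LieAlgebra k A] [LieRing B] [LieAlgebra k B]
    (f : F →ₗ⁅k⁆ A) (g : F →ₗ⁅k⁆ B) (hf : Function.Surjective f) (hg : Function.Surjective g)
    (h : ∀ x, f x = 0 ↔ g x = 0) : Nonempty (A ≃ₗ⁅k⁆ B) := by
  have hfg : ∀ x y, f x = f y ↔ g x = g y := by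
    intro x y
    rw [← sub_eq_zero, ← map_sub, h, map_sub, sub_eq_zero]
  let s := Function.surjInv hf
  have hs : ∀ a, f (s a) = a := Function.surjInv_eq hf
  have key : ∀ x, g (s (f x)) = g x := fun x => (hfg _ _).1 (hs _)
  let φ : A →ₗ⁅k⁆ B :=
    { toFun := fun a => g (s a)
      map_add' := fun a b => by
        rw [← map_add]; apply (hfg _ _).1; rw [map_add, hs, hs, hs]
      map_smul' := fun c a => by
        rw [RingHom.id_apply, ← map_smul]; apply (hfg _ _).1; rw [map_smul, hs, hs]
      map_lie' := fun {a b} => by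
        rw [← LieHom.map_lie]; apply (hfg _ _).1; rw [LieHom.map_lie, hs, hs, hs] }
  refine ⟨LieEquiv.ofBijective φ ⟨?_, ?_⟩⟩
  · intro a b hab
    have : f (s a) = f (s b) := (hfg _ _).2 hab
    rwa [hs, hs] at this
  · intro b
    obtain ⟨x, rfl⟩ := hg b
    exact ⟨f x, key x⟩

/-- The quotient map as a Lie algebra morphism. -/
def qmap {k H : Type u} [Field k] [LieRing H] [LieAlgebra k H] (I : LieIdeal k H) :
    H →ₗ⁅k⁆ H ⧸ I :=
  { (LieSubmodule.Quotient.mk' I : H →ₗ[k] H ⧸ I) with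
    map_lie' := fun {_ _} => rfl }

lemma qmap_surj {k H : Type u} [Field k] [LieRing H] [LieAlgebra k H] (I : LieIdeal k H) :
    Function.Surjective (qmap I) := LieSubmodule.Quotient.surjective_mk' I

lemma qmap_zero {k H : Type u} [Field k] [LieRing H] [LieAlgebra k H] (I : LieIdeal k H) (x : H) :
    qmap I x = 0 ↔ x ∈ I := LieSubmodule.Quotient.mk_eq_zero (N := I)

lemma mem_Z2_quot {k H : Type u} [Field k] [LieRing H] [LieAlgebra k H] (J : LieIdeal k H)
    (x : H) : qmap J x ∈ LieSubmodule.ucs 2 (⊥ : LieIdeal k (H ⧸ J)) ↔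
      ∀ a b : H, ⁅b, ⁅a, x⁆⁆ ∈ J := by
  rw [mem_Z2]
  constructor
  · intro h a b
    rw [← qmap_zero, LieHom.map_lie, LieHom.map_lie]
    exact h _ _
  · intro h a b
    obtain ⟨a, rfl⟩ := qmap_surj J a
    obtain ⟨b, rfl⟩ := qmap_surj J b
    rw [← LieHom.map_lie, ← LieHom.map_lie, qmap_zero]
    exact h _ _

/-- Let `L` have a free presentation `π : F ↠ L` with kernel `R` and let
`J = [[R,F],F]`. Then `L` is 2-capable if and only if `Z₂(F/J) ⊆ R/J`, i.e. iff every element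
of `F` whose image in `F/J` lies in `Z₂(F/J)` belongs to `R`. -/
theorem stmt_10 (k : Type u) [Field k] (L : Type u) [LieRing L] [LieAlgebra k L]
    (X : Type u) (π : FreeLieAlgebra k X →ₗ⁅k⁆ L) (hπ : Function.Surjective π)
    (J : LieIdeal k (FreeLieAlgebra k X))
    (hJ : J = ⁅(⁅π.ker, (⊤ : LieIdeal k (FreeLieAlgebra k X))⁆ :
        LieIdeal k (FreeLieAlgebra k X)), (⊤ : LieIdeal k (FreeLieAlgebra k X))⁆) :
    TwoCapable k L ↔
      ∀ x : FreeLieAlgebra k X,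
        LieSubmodule.Quotient.mk' J x ∈
          LieSubmodule.ucs 2 (⊥ : LieIdeal k (FreeLieAlgebra k X ⧸ J)) →
        x ∈ π.ker := by
  change _ ↔ ∀ x : FreeLieAlgebra k X,
        qmap J x ∈ LieSubmodule.ucs 2 (⊥ : LieIdeal k (FreeLieAlgebra k X ⧸ J)) → x ∈ π.ker
  constructor
  · rintro ⟨H, _, _, ⟨e⟩⟩ x hx
    rw [mem_Z2_quot] at hx
    set Z := LieSubmodule.ucs 2 (⊥ : LieIdeal k H) with hZ
    let φ : FreeLieAlgebra k X →ₗ⁅k⁆ H :=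
      FreeLieAlgebra.lift k fun i =>
        Function.surjInv (qmap_surj Z) (e (π (FreeLieAlgebra.of k i)))
    have hφ : ∀ y, qmap Z (φ y) = e (π y) := by
      have : (qmap Z).comp φ = (e : L →ₗ⁅k⁆ _).comp π := by
        apply FreeLieAlgebra.hom_ext
        intro i
        simp only [LieHom.comp_apply, φ, FreeLieAlgebra.lift_of_apply]
        exact Function.surjInv_eq (qmap_surj Z) _
      intro y
      exact LieHom.congr_fun this y
    have hZ0 : ∀ z ∈ Z, ∀ a b : H, ⁅b, ⁅a, z⁆⁆ = 0 := fun z hz => (mem_Z2 z).1 hz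
    have hR : ∀ r ∈ π.ker, φ r ∈ Z := by
      intro r hr
      rw [← qmap_zero, hφ, (LieHom.mem_ker).1 hr]
      exact map_zero e.toLieHom
    have hφJ : ∀ y ∈ J, φ y = 0 := by
      have h1 : (⁅π.ker, (⊤ : LieIdeal k (FreeLieAlgebra k X))⁆ :
          LieIdeal k (FreeLieAlgebra k X)) ≤
          LieIdeal.comap φ (LieSubmodule.ucs 1 (⊥ : LieIdeal k H)) := by
        rw [LieSubmodule.lieIdeal_oper_eq_span, LieSubmodule.lieSpan_le]
        rintro _ ⟨⟨r, hr⟩, ⟨m, -⟩, rfl⟩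
        change ⁅r, m⁆ ∈ LieIdeal.comap φ _
        rw [LieIdeal.mem_comap, LieHom.map_lie, LieSubmodule.ucs_succ, LieSubmodule.mem_normalizer]
        intro b
        rw [LieSubmodule.ucs_zero, LieSubmodule.mem_bot, ← lie_skew (φ r) (φ m), lie_neg,
          hZ0 _ (hR r hr), neg_zero]
      have h2 : J ≤ φ.ker := by
        rw [hJ, LieSubmodule.lieIdeal_oper_eq_span, LieSubmodule.lieSpan_le]
        rintro _ ⟨⟨r, hr⟩, ⟨m, -⟩, rfl⟩
        have h3 : φ r ∈ LieSubmodule.ucs 1 (⊥ : LieIdeal k H) := h1 hr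
        rw [LieSubmodule.ucs_succ, LieSubmodule.mem_normalizer] at h3
        have h4 := h3 (φ m)
        rw [LieSubmodule.ucs_zero, LieSubmodule.mem_bot] at h4
        change ⁅r, m⁆ ∈ φ.ker
        rw [LieHom.mem_ker, LieHom.map_lie, ← lie_skew, h4, neg_zero]
      exact fun y hy => (LieHom.mem_ker).1 (h2 hy)
    have hdec : ∀ h : H, ∃ a, ∃ z ∈ Z, h = φ a + z := by
      intro h
      obtain ⟨l, hl⟩ := e.surjective (qmap Z h)
      obtain ⟨a, rfl⟩ := hπ l
      refine ⟨a, h - φ a, ?_, by abel⟩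
      rw [← qmap_zero, map_sub, hφ, sub_eq_zero]
      exact hl.symm
    have hxZ : φ x ∈ Z := by
      rw [hZ, mem_Z2]
      intro h' h
      obtain ⟨a, z', hz', rfl⟩ := hdec h'
      obtain ⟨b, z, hz, rfl⟩ := hdec h
      have e0 : ∀ w ∈ Z, ∀ c d : H, ⁅c, ⁅w, d⁆⁆ = 0 := by
        intro w hw c d
        rw [← lie_skew w d, lie_neg, hZ0 _ hw, neg_zero]
      have e1 : ∀ c : H, ⁅c, ⁅z', φ x⁆⁆ = 0 := fun c => e0 _ hz' _ _
      have e2 : ⁅z, ⁅φ a, φ x⁆⁆ = 0 := by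
        rw [leibniz_lie, ← lie_skew ⁅z, φ a⁆ (φ x), e0 _ hz, e0 _ hz, neg_zero, add_zero]
      have e3 : ⁅φ b, ⁅φ a, φ x⁆⁆ = 0 := by
        rw [← LieHom.map_lie, ← LieHom.map_lie]
        exact hφJ _ (hx a b)
      rw [add_lie (φ a), lie_add, e1, add_zero, add_lie, e2, e3, add_zero]
    rw [LieHom.mem_ker]
    rw [← qmap_zero, hφ] at hxZ
    exact e.injective (hxZ.trans (map_zero e.toLieHom).symm)
  · intro h
    refine ⟨FreeLieAlgebra k X ⧸ J, inferInstance, inferInstance, ?_⟩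
    refine equiv_of_ker π ((qmap (LieSubmodule.ucs 2
      (⊥ : LieIdeal k (FreeLieAlgebra k X ⧸ J)))).comp (qmap J)) hπ
      ((qmap_surj _).comp (qmap_surj J)) fun x => ?_
    rw [LieHom.comp_apply, qmap_zero]
    refine ⟨fun hx => ?_, fun hx => (LieHom.mem_ker).1 (h x hx)⟩
    rw [mem_Z2_quot]
    intro a b
    have h1 : ⁅x, a⁆ ∈ (⁅π.ker, (⊤ : LieIdeal k (FreeLieAlgebra k X))⁆ :
          LieIdeal k (FreeLieAlgebra k X)) :=
      LieSubmodule.lie_mem_lie ((LieHom.mem_ker).2 hx) (LieSubmodule.mem_top a)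
    have h2 : ⁅⁅x, a⁆, b⁆ ∈ J := by
      rw [hJ]
      exact LieSubmodule.lie_mem_lie h1 (LieSubmodule.mem_top b)
    have : ⁅b, ⁅a, x⁆⁆ = ⁅⁅x, a⁆, b⁆ := by
      rw [← lie_skew x a, neg_lie, lie_skew]
    rwa [this]
end

section
/- Let L be a Lie algebra over a field k with free presentation π : F ↠ L with kernel R, let π̄ : F/[[R,F],F] ↠ L be the induced epimorphism, and let I be an ideal of L contained in π̄(Z₂(F/[[R,F],F])). Let S = π⁻¹(I), so that F/S is a free presentation of L/I. Then the homomorphism M⁽²⁾(L) = (R ∩ F³)/[[R,F],F] → M⁽²⁾(L/I) = (S ∩ F³)/[[S,F],F] induced by the inclusion R ∩ F³ ⊆ S ∩ F³ is injective; equivalently, (R ∩ F³) ∩ [[S,F],F] ⊆ [[R,F],F]. -/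
open Module

universe u

/-- Let `π : F ↠ L` be a free presentation with kernel `R`, `J = [[R,F],F]`, and
let `I` be an ideal of `L` contained in the image of `Z₂(F/J)` under the induced map `F/J ↠ L`.
With `S = π⁻¹(I)`, the natural map `M⁽²⁾(L) → M⁽²⁾(L/I)` is injective; equivalently
`(R ∩ F³) ∩ [[S,F],F] ⊆ [[R,F],F]`. -/
theorem stmt_11 (k : Type u) [Field k] (L : Type u) [LieRing L] [LieAlgebra k L]
    (X : Type u) (π : FreeLieAlgebra k X →ₗ⁅k⁆ L) (hπ : Function.Surjective π)
    (J : LieIdeal k (FreeLieAlgebra k X))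
    (hJ : J = ⁅(⁅π.ker, (⊤ : LieIdeal k (FreeLieAlgebra k X))⁆ :
        LieIdeal k (FreeLieAlgebra k X)), (⊤ : LieIdeal k (FreeLieAlgebra k X))⁆)
    (I : LieIdeal k L)
    (hI : ∀ y ∈ I, ∃ x : FreeLieAlgebra k X,
        LieSubmodule.Quotient.mk' J x ∈
          LieSubmodule.ucs 2 (⊥ : LieIdeal k (FreeLieAlgebra k X ⧸ J)) ∧ π x = y)
    (S : LieIdeal k (FreeLieAlgebra k X)) (hS : S = LieIdeal.comap π I) :
    (π.ker ⊓
        LieModule.lowerCentralSeries k (FreeLieAlgebra k X) (FreeLieAlgebra k X) 2) ⊓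
      ⁅(⁅S, (⊤ : LieIdeal k (FreeLieAlgebra k X))⁆ : LieIdeal k (FreeLieAlgebra k X)),
        (⊤ : LieIdeal k (FreeLieAlgebra k X))⁆ ≤
    ⁅(⁅π.ker, (⊤ : LieIdeal k (FreeLieAlgebra k X))⁆ : LieIdeal k (FreeLieAlgebra k X)),
      (⊤ : LieIdeal k (FreeLieAlgebra k X))⁆ := by
  have key : S ≤ J.normalizer.normalizer := by
    intro s hs
    rw [hS, LieIdeal.mem_comap] at hs
    obtain ⟨x, hx, hxy⟩ := hI _ hs
    have h1 : x ∈ J.normalizer.normalizer := by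
      simp only [LieSubmodule.mem_normalizer]
      intro a b
      rw [LieSubmodule.ucs_succ, LieSubmodule.ucs_succ, LieSubmodule.ucs_zero] at hx
      simp only [LieSubmodule.mem_normalizer, LieSubmodule.mem_bot] at hx
      have := hx (LieSubmodule.Quotient.mk a) (LieSubmodule.Quotient.mk b)
      exact (LieSubmodule.Quotient.mk_eq_zero' (N := J)).1 this
    have h2 : s - x ∈ J.normalizer.normalizer := by
      have hr : s - x ∈ π.ker := by
        rw [LieHom.mem_ker, map_sub, hxy, sub_self]
      simp only [LieSubmodule.mem_normalizer]
      intro a b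
      rw [hJ, LieSubmodule.lie_comm, LieSubmodule.lie_comm π.ker]
      exact LieSubmodule.lie_mem_lie (LieSubmodule.mem_top _)
        (LieSubmodule.lie_mem_lie (LieSubmodule.mem_top _) hr)
    have := add_mem h2 h1
    rwa [sub_add_cancel] at this
  refine inf_le_right.trans ?_
  rw [← hJ, LieSubmodule.lie_comm, LieSubmodule.lie_comm S,
    LieSubmodule.top_lie_le_iff_le_normalizer, LieSubmodule.top_lie_le_iff_le_normalizer]
  exact key
end

section
/- Let L be a Heisenberg Lie algebra H(m) over a field k (so dim L = 2m+1). Then L is 2-capable if and only if m = 1. -/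
open Module

universe u

section Helpers

variable {k : Type u} [Field k]

theorem heis_data {L : Type u} [LieRing L] [LieAlgebra k L] {m : ℕ} (hL : IsHeisenberg k L m) :
    ∃ z x y : L, ⁅x, y⁆ = z ∧ z ≠ 0 ∧ (∀ a : L, ⁅a, z⁆ = 0) ∧
      (∀ a b : L, ∃ t : k, ⁅a, b⁆ = t • z) ∧
      (∀ c : L, (∀ a : L, ⁅a, c⁆ = 0) → ∃ t : k, c = t • z) := by
  obtain ⟨_, h2, h3⟩ := hL
  have hbr : ∀ a b : L, ⁅a, b⁆ ∈ LieAlgebra.center k L := by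
    intro a b
    rw [← h2, LieModule.lowerCentralSeries_succ, LieModule.lowerCentralSeries_zero]
    exact LieSubmodule.lie_mem_lie (LieSubmodule.mem_top _) (LieSubmodule.mem_top _)
  have hne : ∃ x y : L, ⁅x, y⁆ ≠ 0 := by
    by_contra! h
    have hb : LieModule.lowerCentralSeries k L L 1 = ⊥ := by
      rw [LieModule.lowerCentralSeries_succ, LieModule.lowerCentralSeries_zero, eq_bot_iff,
        LieSubmodule.lieIdeal_oper_eq_span, LieSubmodule.lieSpan_le]
      rintro _ ⟨a, b, rfl⟩
      simpa using h a b
    rw [← h2, hb] at h3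
    have : Module.finrank k (⊥ : LieSubmodule k L L) = 0 := finrank_bot k L
    omega
  obtain ⟨x, y, hxy⟩ := hne
  have hz0 : (⟨⁅x, y⁆, hbr x y⟩ : LieAlgebra.center k L) ≠ 0 := by
    intro h; exact hxy (congrArg Subtype.val h)
  have hsp := (finrank_eq_one_iff_of_nonzero' _ hz0).1 h3
  have hsp' : ∀ c ∈ LieAlgebra.center k L, ∃ t : k, c = t • ⁅x, y⁆ := by
    intro c hc
    obtain ⟨t, ht⟩ := hsp ⟨c, hc⟩
    exact ⟨t, (congrArg Subtype.val ht).symm⟩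
  refine ⟨⁅x, y⁆, x, y, rfl, hxy, fun a => ?_, fun a b => hsp' _ (hbr a b), fun c hc => hsp' c ?_⟩
  · exact (LieModule.mem_maxTrivSubmodule k L L _).1 (hbr x y) a
  · exact (LieModule.mem_maxTrivSubmodule k L L _).2 hc

theorem heis_pair {L : Type u} [LieRing L] [LieAlgebra k L] {m : ℕ}
    (hd : Module.finrank k L = 2 * m + 1) (hm : 2 ≤ m)
    {z x y : L} (hxy : ⁅x, y⁆ = z) (hz0 : z ≠ 0)
    (hbr : ∀ a b : L, ∃ t : k, ⁅a, b⁆ = t • z)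
    (hc : ∀ c : L, (∀ a : L, ⁅a, c⁆ = 0) → ∃ t : k, c = t • z) (w : L) :
    ∃ a b : L, ⁅a, b⁆ = z ∧ ⁅w, a⁆ = 0 ∧ ⁅w, b⁆ = 0 := by
  have : FiniteDimensional k L := Module.finite_of_finrank_pos (by omega)
  by_contra! hcon
  have hab : ∀ a b : L, ⁅w, a⁆ = 0 → ⁅w, b⁆ = 0 → ⁅a, b⁆ = 0 := by
    intro a b ha hb
    obtain ⟨t, ht⟩ := hbr a b
    by_cases h0 : t = 0
    · simp [ht, h0]
    · exact absurd hb (hcon (t⁻¹ • a) b (by rw [smul_lie, ht, smul_smul, inv_mul_cancel₀ h0, one_smul])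
        (by rw [lie_smul, ha, smul_zero]))
  have hc' : ∃ c : L, ⁅w, c⁆ ≠ 0 := by
    by_contra! h
    exact hz0 (hxy ▸ hab x y (h x) (h y))
  obtain ⟨c, hwc⟩ := hc'
  obtain ⟨s, hs⟩ := hbr w c
  have hs0 : s ≠ 0 := by rintro rfl; simp [hs] at hwc
  have hker : ∀ v : L, 2 * m ≤ Module.finrank k (LinearMap.ker (LieAlgebra.ad k L v)) := by
    intro v
    have h1 := LinearMap.finrank_range_add_finrank_ker (LieAlgebra.ad k L v)
    have h2 : LinearMap.range (LieAlgebra.ad k L v) ≤ Submodule.span k {z} := by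
      rintro _ ⟨b, rfl⟩
      obtain ⟨t, ht⟩ := hbr v b
      exact Submodule.mem_span_singleton.2 ⟨t, ht.symm⟩
    have h3 := Submodule.finrank_mono h2
    rw [finrank_span_singleton hz0] at h3
    omega
  have h1 := hker w
  have h2 := hker c
  set A := LinearMap.ker (LieAlgebra.ad k L w) with hA
  set B := LinearMap.ker (LieAlgebra.ad k L c) with hB
  have h3 := Submodule.finrank_sup_add_finrank_inf_eq A B
  have h4 := Submodule.finrank_le (A ⊔ B)
  have h5 : A ⊓ B ≤ Submodule.span k {z} := by
    rintro d ⟨hdA, hdB⟩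
    have hdA : ⁅w, d⁆ = 0 := hdA
    have hdB : ⁅c, d⁆ = 0 := hdB
    obtain ⟨t, ht⟩ := hc d (by
      intro l
      obtain ⟨r, hr⟩ := hbr w l
      have h := hab (l - (r / s) • c) d (by
        rw [lie_sub, lie_smul, hr, hs, smul_smul, div_mul_cancel₀ _ hs0, sub_self]) hdA
      simpa [sub_lie, smul_lie, hdB] using h)
    exact Submodule.mem_span_singleton.2 ⟨t, ht.symm⟩
  have h6 := Submodule.finrank_mono h5
  rw [finrank_span_singleton hz0] at h6
  omega

theorem mem_ucs_one {H : Type u} [LieRing H] [LieAlgebra k H] (h : H) :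
    h ∈ LieSubmodule.ucs 1 (⊥ : LieIdeal k H) ↔ ∀ v : H, ⁅v, h⁆ = 0 := by
  rw [LieSubmodule.ucs_succ, LieSubmodule.ucs_zero, LieSubmodule.mem_normalizer]
  simp

theorem mem_ucs_two {H : Type u} [LieRing H] [LieAlgebra k H] (h : H) :
    h ∈ LieSubmodule.ucs 2 (⊥ : LieIdeal k H) ↔ ∀ v : H, ⁅v, h⁆ ∈ LieSubmodule.ucs 1 (⊥ : LieIdeal k H) := by
  rw [LieSubmodule.ucs_succ, LieSubmodule.mem_normalizer]

theorem not_twoCapable {L : Type u} [LieRing L] [LieAlgebra k L] {m : ℕ}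
    (hL : IsHeisenberg k L m) (hm : 2 ≤ m) : ¬ TwoCapable k L := by
  rintro ⟨H, _, _, ⟨e⟩⟩
  obtain ⟨z, x, y, hxy, hz0, hzc, hbr, hc⟩ := heis_data hL
  let I := LieSubmodule.ucs 2 (⊥ : LieIdeal k H)
  have hsurj : ∀ l : L, ∃ h : H, LieSubmodule.Quotient.mk' I h = e l := fun l =>
    LieSubmodule.Quotient.surjective_mk' I (e l)
  have hbrq : ∀ a b : H, LieSubmodule.Quotient.mk' I ⁅a, b⁆
      = ⁅(LieSubmodule.Quotient.mk' I a : H ⧸ I), (LieSubmodule.Quotient.mk' I b : H ⧸ I)⁆ :=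
    fun a b => rfl
  have hmk : ∀ h : H, LieSubmodule.Quotient.mk' I h = 0 ↔ h ∈ I := fun h =>
    LieSubmodule.Quotient.mk_eq_zero I
  have he0 : e 0 = 0 := e.toLinearEquiv.map_zero
  obtain ⟨h, hh⟩ := hsurj z
  have hhI : h ∈ I := by
    refine (mem_ucs_two h).2 fun w => ?_
    obtain ⟨l, hl⟩ : ∃ l, e l = LieSubmodule.Quotient.mk' I w := e.surjective _
    obtain ⟨a, b, hab, hwa, hwb⟩ := heis_pair hL.1 hm hxy hz0 hbr hc l
    obtain ⟨a', ha'⟩ := hsurj a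
    obtain ⟨b', hb'⟩ := hsurj b
    have h1 : ⁅w, a'⁆ ∈ I := by
      rw [← hmk, hbrq, ← hl, ha', ← LieEquiv.map_lie, hwa, he0]
    have h2 : ⁅w, b'⁆ ∈ I := by
      rw [← hmk, hbrq, ← hl, hb', ← LieEquiv.map_lie, hwb, he0]
    have h3 : h - ⁅a', b'⁆ ∈ I := by
      rw [← hmk, map_sub, hbrq, hh, ha', hb', ← LieEquiv.map_lie, hab, sub_self]
    have e1 : ⁅w, h⁆ = ⁅w, h - ⁅a', b'⁆⁆ + (⁅a', ⁅w, b'⁆⁆ - ⁅b', ⁅w, a'⁆⁆) := by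
      rw [lie_sub, leibniz_lie w a' b', ← lie_skew b' ⁅w, a'⁆]; abel
    rw [e1]
    exact add_mem ((mem_ucs_two _).1 h3 w)
      (sub_mem ((mem_ucs_two _).1 h2 a') ((mem_ucs_two _).1 h1 b'))
  rw [← hmk, hh] at hhI
  exact hz0 (e.injective (hhI.trans he0.symm))

/-- The 5-dimensional filiform Lie algebra. -/
@[ext] structure Fil (k : Type u) where
  a : k
  b : k
  c : k
  d : k
  e : k

def filEquiv (k : Type u) : Fil k ≃ (k × k × k × k × k) where
  toFun x := (x.a, x.b, x.c, x.d, x.e)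
  invFun x := ⟨x.1, x.2.1, x.2.2.1, x.2.2.2.1, x.2.2.2.2⟩
  left_inv _ := rfl
  right_inv _ := rfl

instance : AddCommGroup (Fil k) := (filEquiv k).addCommGroup

instance : Module k (Fil k) := (filEquiv k).module k

@[simp] theorem Fil.add_def (x y : Fil k) :
    x + y = ⟨x.a + y.a, x.b + y.b, x.c + y.c, x.d + y.d, x.e + y.e⟩ := rfl
@[simp] theorem Fil.zero_def : (0 : Fil k) = ⟨0, 0, 0, 0, 0⟩ := rfl
@[simp] theorem Fil.smul_def (t : k) (x : Fil k) :
    t • x = ⟨t * x.a, t * x.b, t * x.c, t * x.d, t * x.e⟩ := rfl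

instance : Bracket (Fil k) (Fil k) :=
  ⟨fun x y => ⟨0, 0, x.a * y.b - y.a * x.b, x.a * y.c - y.a * x.c, x.a * y.d - y.a * x.d⟩⟩

@[simp] theorem Fil.lie_def (x y : Fil k) : ⁅x, y⁆ =
  ⟨0, 0, x.a * y.b - y.a * x.b, x.a * y.c - y.a * x.c, x.a * y.d - y.a * x.d⟩ := rfl

instance : LieRing (Fil k) where
  add_lie x y z := by ext <;> simp <;> ring
  lie_add x y z := by ext <;> simp <;> ring
  lie_self x := by ext <;> simp
  leibniz_lie x y z := by ext <;> simp <;> ring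

instance : LieAlgebra k (Fil k) where
  lie_smul t x y := by ext <;> simp <;> ring

theorem Fil.mem_ucs (h : Fil k) :
    h ∈ LieSubmodule.ucs 2 (⊥ : LieIdeal k (Fil k)) ↔ h.a = 0 ∧ h.b = 0 ∧ h.c = 0 := by
  rw [mem_ucs_two]
  simp only [mem_ucs_one]
  constructor
  · intro H
    have h1 := H ⟨1, 0, 0, 0, 0⟩ ⟨1, 0, 0, 0, 0⟩
    have h2 := H ⟨0, 1, 0, 0, 0⟩ ⟨1, 0, 0, 0, 0⟩
    simp at h1 h2
    exact ⟨h2, h1.1, h1.2⟩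
  · rintro ⟨h1, h2, h3⟩ v w
    simp [h1, h2, h3]

theorem twoCapable_of_one {L : Type u} [LieRing L] [LieAlgebra k L]
    (hL : IsHeisenberg k L 1) : TwoCapable k L := by
  obtain ⟨z, x, y, hxy, hz0, hzc, hbr, hc⟩ := heis_data hL
  have hd := hL.1
  have : FiniteDimensional k L := Module.finite_of_finrank_pos (by omega)
  have hzc' : ∀ a : L, ⁅z, a⁆ = 0 := fun a => by rw [← lie_skew, hzc, neg_zero]
  have hyx : ⁅y, x⁆ = -z := by rw [← lie_skew, hxy]
  have hli : ∀ a b c : k, a • x + b • y + c • z = 0 → a = 0 ∧ b = 0 ∧ c = 0 := by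
    intro a b c h
    have h1 : ⁅a • x + b • y + c • z, y⁆ = 0 := by rw [h, zero_lie]
    have h2 : ⁅x, a • x + b • y + c • z⁆ = 0 := by rw [h, lie_zero]
    simp [hxy, hzc', hz0] at h1
    simp [hxy, hzc, hz0] at h2
    subst h1 h2
    simpa [hz0] using h
  let f : (k × k × k) →ₗ[k] L :=
    { toFun := fun p => p.1 • x + p.2.1 • y + p.2.2 • z
      map_add' := by intro p q; simp only [Prod.fst_add, Prod.snd_add]; module
      map_smul' := by intro t p; simp only [Prod.smul_fst, Prod.smul_snd, smul_eq_mul, RingHom.id_apply]; module }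
  have hfi : Function.Injective f := by
    rw [injective_iff_map_eq_zero]
    intro p hp
    obtain ⟨h1, h2, h3⟩ := hli _ _ _ hp
    ext <;> simp [h1, h2, h3]
  have hfs : Function.Surjective f := by
    refine (LinearMap.injective_iff_surjective_of_finrank_eq_finrank ?_).1 hfi
    simp [hd]
  let φ : Fil k →ₗ⁅k⁆ L :=
    { toFun := fun p => p.a • x + p.b • y + p.c • z
      map_add' := by intro p q; simp only [Fil.add_def]; module
      map_smul' := by intro t p; simp only [Fil.smul_def, RingHom.id_apply]; module
      map_lie' := by
        intro p q
        simp only [Fil.lie_def, add_lie, lie_add, smul_lie, lie_smul, hxy, hyx, lie_self, hzc, hzc']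
        module }
  have hφs : Function.Surjective φ := by
    intro l
    obtain ⟨p, hp⟩ := hfs l
    exact ⟨⟨p.1, p.2.1, p.2.2, 0, 0⟩, hp⟩
  have hker : φ.ker = LieSubmodule.ucs 2 (⊥ : LieIdeal k (Fil k)) := by
    ext p
    rw [LieHom.mem_ker, Fil.mem_ucs]
    constructor
    · exact hli _ _ _
    · rintro ⟨h1, h2, h3⟩
      change p.a • x + p.b • y + p.c • z = 0
      simp [h1, h2, h3]
  refine ⟨Fil k, inferInstance, inferInstance, ?_⟩
  rw [← hker]
  have hr : φ.range = ⊤ := (LieHom.range_eq_top φ).2 hφs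
  exact ⟨((φ.quotKerEquivRange.trans (LieEquiv.ofEq _ _ (by rw [hr]))).trans
    LieSubalgebra.topEquiv).symm⟩

end Helpers

/-- A Heisenberg Lie algebra `H(m)` is 2-capable if and only if `m = 1`. -/
theorem stmt_12 (k : Type u) [Field k] (L : Type u) [LieRing L] [LieAlgebra k L]
    (m : ℕ) (hL : IsHeisenberg k L m) :
    TwoCapable k L ↔ m = 1 := by
  constructor
  · intro h
    have h2 : ¬ 2 ≤ m := fun hm => not_twoCapable hL hm h
    have h0 : m ≠ 0 := by
      rintro rfl
      obtain ⟨z, x, y, hxy, hz0, hzc, hbr, hc⟩ := heis_data hL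
      obtain ⟨t, ht⟩ := (finrank_eq_one_iff_of_nonzero' z hz0).1 hL.1 y
      apply hz0
      rw [← hxy, ← ht, lie_smul, hzc, smul_zero]
    omega
  · rintro rfl
    exact twoCapable_of_one hL
end

section
/- Let m ≥ 2 and let L be a Heisenberg Lie algebra H(m) over a field k. Then L is not 2-capable. -/
open Module

universe u

theorem heis_aux (k : Type u) [Field k] (L : Type u) [LieRing L] [LieAlgebra k L]
    (m : ℕ) (hm : 2 ≤ m) (hL : IsHeisenberg k L m) :
    ∃ z : L, z ≠ 0 ∧ ∀ x : L, ∃ a b : L, ⁅x, a⁆ = 0 ∧ ⁅x, b⁆ = 0 ∧ ⁅a, b⁆ = z := by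
  obtain ⟨h1, h2, h3⟩ := hL
  have : FiniteDimensional k L := Module.finite_of_finrank_pos (by omega)
  have hc : ∀ x y : L, ⁅x, y⁆ ∈ LieAlgebra.center k L := by
    intro x y
    rw [← h2]
    simp only [LieModule.lowerCentralSeries_succ, LieModule.lowerCentralSeries_zero]
    exact LieSubmodule.lie_mem_lie (LieSubmodule.mem_top _) (LieSubmodule.mem_top _)
  have hcen : ∀ u : L, u ∈ LieAlgebra.center k L ↔ ∀ w : L, ⁅u, w⁆ = 0 := by
    intro u
    rw [LieModule.mem_maxTrivSubmodule]
    refine forall_congr' fun w => ?_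
    rw [← lie_skew, neg_eq_zero]
  obtain ⟨z, hz0, hz⟩ := finrank_eq_one_iff'.mp h3
  have hspan : ∀ u v : L, u ∈ LieAlgebra.center k L → u ≠ 0 → v ∈ LieAlgebra.center k L →
      ∃ c : k, v = c • u := by
    intro u v hu hu0 hv
    obtain ⟨c, hc'⟩ := hz ⟨u, hu⟩
    obtain ⟨d, hd⟩ := hz ⟨v, hv⟩
    have e1 : c • (z : L) = u := congrArg Subtype.val hc'
    have e2 : d • (z : L) = v := congrArg Subtype.val hd
    have hc0 : c ≠ 0 := by
      rintro rfl
      exact hu0 (by rw [← e1, zero_smul])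
    refine ⟨d * c⁻¹, ?_⟩
    rw [← e1, ← e2, smul_smul, mul_assoc, inv_mul_cancel₀ hc0, mul_one]
  refine ⟨z, fun h => hz0 (Subtype.ext h), fun x => ?_⟩
  have key : ∃ a b : L, ⁅x, a⁆ = 0 ∧ ⁅x, b⁆ = 0 ∧ ⁅a, b⁆ ≠ 0 := by
    by_contra! hno
    -- a partner y
    obtain ⟨y, hy⟩ : ∃ y : L, ∀ w : L, ∃ c : k, ⁅x, w⁆ = c • ⁅x, y⁆ := by
      by_cases hx : ∃ y : L, ⁅x, y⁆ ≠ 0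
      · obtain ⟨y, hy⟩ := hx
        exact ⟨y, fun w => hspan _ _ (hc x y) hy (hc x w)⟩
      · push Not at hx
        exact ⟨0, fun w => ⟨0, by rw [hx w, zero_smul]⟩⟩
    let ad1 : L →ₗ[k] (LieAlgebra.center k L).toSubmodule :=
      LinearMap.codRestrict _ (LieAlgebra.ad k L x) (fun w => hc x w)
    let ad2 : L →ₗ[k] (LieAlgebra.center k L).toSubmodule :=
      LinearMap.codRestrict _ (LieAlgebra.ad k L y) (fun w => hc y w)
    have hrn := LinearMap.finrank_range_add_finrank_ker (ad1.prod ad2)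
    have hle : LinearMap.ker (ad1.prod ad2) ≤ (LieAlgebra.center k L).toSubmodule := by
      intro u hu
      rw [LinearMap.mem_ker] at hu
      have u1 : ⁅x, u⁆ = 0 := congrArg (fun p => (p.1 : L)) hu
      have u2 : ⁅y, u⁆ = 0 := congrArg (fun p => (p.2 : L)) hu
      refine (hcen u).mpr fun w => ?_
      obtain ⟨c, hw⟩ := hy w
      have h5 := hno u (w - c • y) u1 (by rw [lie_sub, lie_smul, hw, sub_self])
      rw [lie_sub, lie_smul, ← lie_skew u y, u2] at h5
      simpa using h5
    have hk := Submodule.finrank_mono hle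
    have hr := Submodule.finrank_le (LinearMap.range (ad1.prod ad2))
    rw [Module.finrank_prod] at hr
    have h3' : finrank k (LieAlgebra.center k L).toSubmodule = 1 := h3
    omega
  obtain ⟨a, b, ha, hb, hab⟩ := key
  obtain ⟨c, e⟩ := hspan _ _ (hc a b) hab z.2
  exact ⟨c • a, b, by rw [lie_smul, ha, smul_zero], hb, by rw [smul_lie, ← e]⟩

/-- For `m ≥ 2`, a Heisenberg Lie algebra `H(m)` is not 2-capable. -/
theorem stmt_13 (k : Type u) [Field k] (L : Type u) [LieRing L] [LieAlgebra k L]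
    (m : ℕ) (hm : 2 ≤ m) (hL : IsHeisenberg k L m) :
    ¬ TwoCapable k L := by
  rintro ⟨H, _, _, ⟨e⟩⟩
  obtain ⟨z, hz0, hz⟩ := heis_aux k L m hm hL
  have hmk : ∀ l : L, ∃ h : H, LieSubmodule.Quotient.mk h = e l := fun l =>
    Submodule.Quotient.mk_surjective _ (e l)
  have hmem : ∀ h : H, h ∈ LieSubmodule.ucs 2 (⊥ : LieIdeal k H) ↔ ∀ x y : H, ⁅y, ⁅x, h⁆⁆ = 0 := by
    intro h
    simp [LieSubmodule.ucs_succ, LieSubmodule.mem_normalizer]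
  have hq : ∀ h : H, (LieSubmodule.Quotient.mk h : H ⧸ LieSubmodule.ucs 2 (⊥ : LieIdeal k H)) = 0 ↔
      ∀ x y : H, ⁅y, ⁅x, h⁆⁆ = 0 := fun h =>
    (LieSubmodule.Quotient.mk_eq_zero').trans (hmem h)
  obtain ⟨z', hz'⟩ := hmk z
  have : e z = 0 := by
    rw [← hz', hq]
    intro x w
    obtain ⟨a, b, ha, hb, hab⟩ := hz (e.symm (LieSubmodule.Quotient.mk x))
    obtain ⟨a', ha'⟩ := hmk a
    obtain ⟨b', hb'⟩ := hmk b
    have e1 := (hq ⁅x, a'⁆).mp (by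
      rw [LieSubmodule.Quotient.mk_bracket, ha']
      rw [← e.apply_symm_apply (LieSubmodule.Quotient.mk x), ← LieEquiv.map_lie, ha, map_zero])
    have e2 := (hq ⁅x, b'⁆).mp (by
      rw [LieSubmodule.Quotient.mk_bracket, hb']
      rw [← e.apply_symm_apply (LieSubmodule.Quotient.mk x), ← LieEquiv.map_lie, hb, map_zero])
    have e3 := (hq (z' - ⁅a', b'⁆)).mp (by
      have : (LieSubmodule.Quotient.mk (z' - ⁅a', b'⁆) :
        H ⧸ LieSubmodule.ucs 2 (⊥ : LieIdeal k H)) = LieSubmodule.Quotient.mk z' -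
          LieSubmodule.Quotient.mk ⁅a', b'⁆ := rfl
      rw [this, LieSubmodule.Quotient.mk_bracket, ha', hb', hz', ← hab, LieEquiv.map_lie, sub_self]) x w
    rw [lie_sub, lie_sub, leibniz_lie x a' b', ← lie_skew ⁅x, a'⁆ b', lie_add, lie_neg, e1, e2] at e3
    simpa using e3
  exact hz0 (by simpa using this)
end

section
/- Let L be a finite-dimensional Lie algebra over a field k and I an ideal of L. Then dim M⁽²⁾(L/I) ≤ dim M⁽²⁾(L) + dim (I ∩ L³)/[[I,L],L], where L³ = γ₃(L) is the third term of the lower central series of L. -/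
open Module

universe u

theorem subQuotRank_le_of_inj15 (k : Type u) [Field k] {V W : Type u} [AddCommGroup V] [Module k V]
    [AddCommGroup W] [Module k W] (g : V →ₗ[k] W) (A B : Submodule k V) (C D : Submodule k W)
    (hA : ∀ x ∈ A, g x ∈ C) (hB : ∀ x ∈ B, g x ∈ D) (hinj : ∀ x ∈ A, g x ∈ D → x ∈ B) :
    subQuotRank k A B ≤ subQuotRank k C D := by
  unfold subQuotRank
  refine LinearMap.rank_le_of_injective
    (Submodule.mapQ (B.comap A.subtype) (D.comap C.subtype) (g.restrict hA)
      (fun x hx => hB _ hx)) ?_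
  rw [injective_iff_map_eq_zero]
  intro y
  obtain ⟨y, rfl⟩ := Submodule.Quotient.mk_surjective _ y
  intro hy
  replace hy := (Submodule.Quotient.mk_eq_zero (D.comap C.subtype)).1 hy
  rw [Submodule.Quotient.mk_eq_zero]
  exact hinj _ y.2 hy

theorem subQuotRank_le_add15 (k : Type u) [Field k] {V W : Type u} [AddCommGroup V] [Module k V]
    [AddCommGroup W] [Module k W] (p : V →ₗ[k] W) (A B A₁ B₁ : Submodule k V)
    (C D : Submodule k W)
    (hA : ∀ x ∈ A, p x ∈ C) (hB : ∀ x ∈ B, p x ∈ D) (hA₁ : A₁ ≤ A) (hB₁ : B₁ ≤ B)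
    (hex : ∀ x ∈ A, p x ∈ D → ∃ y ∈ B, x - y ∈ A₁) :
    subQuotRank k A B ≤ subQuotRank k A₁ B₁ + subQuotRank k C D := by
  unfold subQuotRank
  let f := Submodule.mapQ (B.comap A.subtype) (D.comap C.subtype) (p.restrict hA)
      (fun x hx => hB _ hx)
  let i := Submodule.mapQ (B₁.comap A₁.subtype) (B.comap A.subtype) (Submodule.inclusion hA₁)
      (fun x hx => hB₁ hx)
  have h1 : LinearMap.ker f ≤ LinearMap.range i := by
    intro y
    obtain ⟨y, rfl⟩ := Submodule.Quotient.mk_surjective _ y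
    intro hy
    replace hy := (Submodule.Quotient.mk_eq_zero (D.comap C.subtype)).1 hy
    obtain ⟨z, hz, hyz⟩ := hex _ y.2 hy
    refine ⟨Submodule.Quotient.mk ⟨_, hyz⟩, ?_⟩
    refine (Submodule.Quotient.eq (B.comap A.subtype)).2 ?_
    change (y : V) - z - y ∈ B
    simpa using hz
  rw [← LinearMap.rank_range_add_rank_ker f, add_comm]
  exact add_le_add ((Submodule.rank_mono h1).trans (rank_range_le i))
    (Submodule.rank_le _)

section LieHelpers

variable {k : Type u} [Field k] {F G : Type u} [LieRing F] [LieAlgebra k F]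
  [LieRing G] [LieAlgebra k G]

theorem lie_top_map15 (f : F →ₗ⁅k⁆ G) (I : LieIdeal k F) (J : LieIdeal k G)
    (h : ∀ x ∈ I, f x ∈ J) :
    ∀ x ∈ ⁅I, (⊤ : LieIdeal k F)⁆, f x ∈ ⁅J, (⊤ : LieIdeal k G)⁆ := by
  have h1 : ⁅I, (⊤ : LieIdeal k F)⁆ ≤ LieIdeal.comap f ⁅J, (⊤ : LieIdeal k G)⁆ := by
    rw [LieSubmodule.lie_le_iff]
    intro x hx m _
    rw [LieIdeal.mem_comap, LieHom.map_lie]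
    exact LieSubmodule.lie_mem_lie (h x hx) (LieSubmodule.mem_top _)
  intro x hx
  exact LieIdeal.mem_comap.1 (h1 hx)

theorem lcs_map15 (f : F →ₗ⁅k⁆ G) (n : ℕ) :
    ∀ x ∈ LieModule.lowerCentralSeries k F F n, f x ∈ LieModule.lowerCentralSeries k G G n := by
  intro x hx
  exact LieIdeal.map_lowerCentralSeries_le n (LieIdeal.mem_map hx)

theorem lie_top_lift15 (f : F →ₗ⁅k⁆ G) (hf : Function.Surjective f) (I : LieIdeal k F)
    (J : LieIdeal k G) (h : ∀ y ∈ J, ∃ x ∈ I, f x = y) :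
    ∀ y ∈ ⁅J, (⊤ : LieIdeal k G)⁆, ∃ x ∈ ⁅I, (⊤ : LieIdeal k F)⁆, f x = y := by
  intro y hy
  rw [← LieSubmodule.mem_toSubmodule, LieSubmodule.lieIdeal_oper_eq_linear_span'] at hy
  induction hy using Submodule.span_induction with
  | mem y hy =>
    obtain ⟨a, ha, b, -, rfl⟩ := hy
    obtain ⟨a, ha', rfl⟩ := h a ha
    obtain ⟨b, rfl⟩ := hf b
    exact ⟨⁅a, b⁆, LieSubmodule.lie_mem_lie ha' (LieSubmodule.mem_top _), LieHom.map_lie _ _ _⟩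
  | zero => exact ⟨0, zero_mem _, map_zero _⟩
  | add y z _ _ ih1 ih2 =>
    obtain ⟨a, ha, rfl⟩ := ih1
    obtain ⟨b, hb, rfl⟩ := ih2
    exact ⟨a + b, add_mem ha hb, map_add _ _ _⟩
  | smul t y _ ih =>
    obtain ⟨a, ha, rfl⟩ := ih
    exact ⟨t • a, SMulMemClass.smul_mem t ha, map_smul _ _ _⟩

theorem lie_lcs_one15 (R : LieIdeal k F) (r b : F) (hr : r ∈ R)
    (hb : b ∈ ⁅(⊤ : LieIdeal k F), (⊤ : LieIdeal k F)⁆) :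
    ⁅r, b⁆ ∈ (⁅(⁅R, (⊤ : LieIdeal k F)⁆ : LieIdeal k F), (⊤ : LieIdeal k F)⁆ : LieIdeal k F) := by
  rw [← LieSubmodule.mem_toSubmodule, LieSubmodule.lieIdeal_oper_eq_linear_span'] at hb
  induction hb using Submodule.span_induction with
  | mem y hy =>
    obtain ⟨c, -, d, -, rfl⟩ := hy
    rw [leibniz_lie]
    refine add_mem (LieSubmodule.lie_mem_lie (LieSubmodule.lie_mem_lie hr
      (LieSubmodule.mem_top _)) (LieSubmodule.mem_top _)) ?_
    rw [LieSubmodule.lie_comm]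
    exact LieSubmodule.lie_mem_lie (LieSubmodule.mem_top _) (LieSubmodule.lie_mem_lie hr
      (LieSubmodule.mem_top _))
  | zero => rw [lie_zero]; exact zero_mem _
  | add y z _ _ ih1 ih2 => rw [lie_add]; exact add_mem ih1 ih2
  | smul t y _ ih => rw [lie_smul]; exact SMulMemClass.smul_mem t ih

theorem congr_one15 (R : LieIdeal k F) (h : F →ₗ⁅k⁆ F) (hh : ∀ x, h x - x ∈ R) (b : F)
    (hb : b ∈ ⁅(⊤ : LieIdeal k F), (⊤ : LieIdeal k F)⁆) :
    h b - b ∈ (⁅R, (⊤ : LieIdeal k F)⁆ : LieIdeal k F) := by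
  rw [← LieSubmodule.mem_toSubmodule, LieSubmodule.lieIdeal_oper_eq_linear_span'] at hb
  induction hb using Submodule.span_induction with
  | mem y hy =>
    obtain ⟨c, -, d, -, rfl⟩ := hy
    have : h ⁅c, d⁆ - ⁅c, d⁆ = ⁅h c, h d - d⁆ + ⁅h c - c, d⁆ := by
      rw [LieHom.map_lie, lie_sub, sub_lie]; abel
    rw [this]
    refine add_mem ?_ (LieSubmodule.lie_mem_lie (hh _) (LieSubmodule.mem_top _))
    rw [LieSubmodule.lie_comm]
    exact LieSubmodule.lie_mem_lie (LieSubmodule.mem_top _) (hh _)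
  | zero => simp
  | add y z _ _ ih1 ih2 =>
    rw [map_add, add_sub_add_comm]; exact add_mem ih1 ih2
  | smul t y _ ih => rw [map_smul, ← smul_sub]; exact SMulMemClass.smul_mem t ih

theorem congr_two15 (R : LieIdeal k F) (h : F →ₗ⁅k⁆ F) (hh : ∀ x, h x - x ∈ R) (b : F)
    (hb : b ∈ LieModule.lowerCentralSeries k F F 2) :
    h b - b ∈
      (⁅(⁅R, (⊤ : LieIdeal k F)⁆ : LieIdeal k F), (⊤ : LieIdeal k F)⁆ : LieIdeal k F) := by
  rw [LieModule.lowerCentralSeries_succ, LieModule.lowerCentralSeries_succ,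
    LieModule.lowerCentralSeries_zero,
    ← LieSubmodule.mem_toSubmodule, LieSubmodule.lieIdeal_oper_eq_linear_span'] at hb
  induction hb using Submodule.span_induction with
  | mem y hy =>
    obtain ⟨c, -, d, hd, rfl⟩ := hy
    have : h ⁅c, d⁆ - ⁅c, d⁆ = ⁅h c, h d - d⁆ + ⁅h c - c, d⁆ := by
      rw [LieHom.map_lie, lie_sub, sub_lie]; abel
    rw [this]
    refine add_mem ?_ (lie_lcs_one15 R _ _ (hh c) hd)
    rw [LieSubmodule.lie_comm]
    exact LieSubmodule.lie_mem_lie (LieSubmodule.mem_top _) (congr_one15 R h hh d hd)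
  | zero => simp
  | add y z _ _ ih1 ih2 =>
    rw [map_add, add_sub_add_comm]; exact add_mem ih1 ih2
  | smul t y _ ih => rw [map_smul, ← smul_sub]; exact SMulMemClass.smul_mem t ih

/-- The quotient map as a morphism of Lie algebras. -/
def quotHom15 (I : LieIdeal k F) : F →ₗ⁅k⁆ (F ⧸ I) :=
  { I.toSubmodule.mkQ with
    map_lie' := fun {_ _} => rfl }

theorem exists_lift15 {X Q : Type u} [LieRing Q] [LieAlgebra k Q]
    (a : FreeLieAlgebra k X →ₗ⁅k⁆ Q) (p : G →ₗ⁅k⁆ Q) (hp : Function.Surjective p) :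
    ∃ f : FreeLieAlgebra k X →ₗ⁅k⁆ G, ∀ x, p (f x) = a x := by
  choose s hs using hp
  refine ⟨FreeLieAlgebra.lift k (fun x => s (a (FreeLieAlgebra.of k x))), fun x => ?_⟩
  have : p.comp (FreeLieAlgebra.lift k (fun x => s (a (FreeLieAlgebra.of k x)))) = a := by
    apply FreeLieAlgebra.hom_ext
    intro x
    rw [LieHom.comp_apply, FreeLieAlgebra.lift_of_apply, hs]
  exact LieHom.congr_fun this x

end LieHelpers

theorem m2Rank_le15 (k : Type u) [Field k] (Q : Type u) [LieRing Q] [LieAlgebra k Q]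
    (X : Type u) (π : FreeLieAlgebra k X →ₗ⁅k⁆ Q) (hπ : Function.Surjective π)
    (X' : Type u) (π' : FreeLieAlgebra k X' →ₗ⁅k⁆ Q) (hπ' : Function.Surjective π') :
    m2Rank k π' ≤ m2Rank k π := by
  obtain ⟨f, hf⟩ := exists_lift15 π π' hπ'
  obtain ⟨g, hg⟩ := exists_lift15 π' π hπ
  have hfk : ∀ x ∈ π.ker, f x ∈ π'.ker := by
    intro x hx
    rw [LieHom.mem_ker] at hx ⊢
    rw [hf, hx]
  have hgk : ∀ x ∈ π'.ker, g x ∈ π.ker := by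
    intro x hx
    rw [LieHom.mem_ker] at hx ⊢
    rw [hg, hx]
  have hf2 := lie_top_map15 f _ _ (lie_top_map15 f _ _ hfk)
  have hg2 := lie_top_map15 g _ _ (lie_top_map15 g _ _ hgk)
  refine subQuotRank_le_of_inj15 k (g : FreeLieAlgebra k X' →ₗ[k] FreeLieAlgebra k X) _ _ _ _
    ?_ hg2 ?_
  · rintro x ⟨hx1, hx2⟩
    exact ⟨hgk x hx1, lcs_map15 g 2 x hx2⟩
  · rintro x ⟨hx1, hx2⟩ hgx
    have h1 := congr_two15 π'.ker (f.comp g) (fun y => by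
      rw [LieHom.mem_ker, map_sub, LieHom.comp_apply, hf, hg, sub_self]) x hx2
    have h2 := hf2 _ hgx
    have h3 := sub_mem h2 h1
    have h4 : f (g x) - (f.comp g x - x) = x := by
      rw [LieHom.comp_apply]; abel
    exact h4 ▸ h3

/-- Let `L` be a finite-dimensional Lie algebra and `I` an ideal of `L`. Then
`dim M⁽²⁾(L/I) ≤ dim M⁽²⁾(L) + dim (I ∩ L³)/[[I,L],L]`. -/
theorem stmt_15 (k : Type u) [Field k] (L : Type u) [LieRing L] [LieAlgebra k L]
    [FiniteDimensional k L] (I : LieIdeal k L)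
    (X : Type u) (π : FreeLieAlgebra k X →ₗ⁅k⁆ L) (hπ : Function.Surjective π)
    (X' : Type u) (π' : FreeLieAlgebra k X' →ₗ⁅k⁆ (L ⧸ I)) (hπ' : Function.Surjective π') :
    m2Rank k π' ≤
      m2Rank k π +
        subQuotRank k (I ⊓ LieModule.lowerCentralSeries k L L 2).toSubmodule
          (⁅(⁅I, (⊤ : LieIdeal k L)⁆ : LieIdeal k L), (⊤ : LieIdeal k L)⁆ :
            LieIdeal k L).toSubmodule := by
  have hq : Function.Surjective (quotHom15 I) := Submodule.mkQ_surjective _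
  have hqk : ∀ x, quotHom15 I x = 0 ↔ x ∈ I := fun x => Submodule.Quotient.mk_eq_zero _
  refine (m2Rank_le15 k _ X ((quotHom15 I).comp π) (hq.comp hπ) X' π' hπ').trans ?_
  have hS : ∀ x, x ∈ ((quotHom15 I).comp π).ker ↔ π x ∈ I := fun x => by
    rw [LieHom.mem_ker, LieHom.comp_apply, hqk]
  have hRS : π.ker ≤ ((quotHom15 I).comp π).ker := by
    intro x hx
    rw [hS, LieHom.mem_ker.1 hx]
    exact zero_mem _
  have hB := lie_top_map15 π _ _ (lie_top_map15 π _ _ (fun x hx => (hS x).1 hx))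
  have hl := lie_top_lift15 π hπ _ _ (lie_top_lift15 π hπ ((quotHom15 I).comp π).ker I
    (fun y hy => by
      obtain ⟨x, rfl⟩ := hπ y
      exact ⟨x, (hS x).2 hy, rfl⟩))
  refine subQuotRank_le_add15 k (π : FreeLieAlgebra k X →ₗ[k] L) _ _ _ _ _ _ ?_ hB ?_ ?_ ?_
  · rintro x ⟨hx1, hx2⟩
    exact ⟨(hS x).1 hx1, lcs_map15 π 2 x hx2⟩
  · rintro x ⟨hx1, hx2⟩
    exact ⟨hRS hx1, hx2⟩
  · exact LieSubmodule.mono_lie (LieSubmodule.mono_lie hRS le_rfl) le_rfl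
  · rintro x ⟨hx1, hx2⟩ hpx
    obtain ⟨y, hy, hxy⟩ := hl _ hpx
    refine ⟨y, hy, ?_, ?_⟩
    · change x - y ∈ π.ker
      rw [LieHom.mem_ker, map_sub, hxy]
      exact sub_self _
    · refine sub_mem hx2 ?_
      change y ∈ LieModule.lowerCentralSeries k (FreeLieAlgebra k X) (FreeLieAlgebra k X) 2
      rw [LieModule.lowerCentralSeries_succ, LieModule.lowerCentralSeries_succ,
        LieModule.lowerCentralSeries_zero, LieSubmodule.lie_comm]
      exact LieSubmodule.mono_lie (LieSubmodule.mono_lie le_top le_rfl) le_rfl hy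
end

section
/- Let L be a Lie algebra over a field k with free presentation π : F ↠ L with kernel R, let I be an ideal of L and S = π⁻¹(I), so that F/S is a free presentation of L/I and M⁽²⁾(L/I) = (S ∩ F³)/[[S,F],F]. Then the cokernel of the natural map M⁽²⁾(L) → M⁽²⁾(L/I) is isomorphic to (I ∩ L³)/[[I,L],L]; that is, there is a k-vector space isomorphism (S ∩ F³)/((R ∩ F³) + [[S,F],F]) ≅ (I ∩ L³)/[[I,L],L], where L³ = γ₃(L). -/
open Module

universe u

/-- Let `π : F ↠ L` be a free presentation with kernel `R`, `I` an ideal of `L`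
and `S = π⁻¹(I)`. Then the cokernel of the natural map `M⁽²⁾(L) → M⁽²⁾(L/I)` is isomorphic to
`(I ∩ L³)/[[I,L],L]`: there is a `k`-linear isomorphism
`(S ∩ F³)/((R ∩ F³) + [[S,F],F]) ≅ (I ∩ L³)/[[I,L],L]`. -/
theorem stmt_16 (k : Type u) [Field k] (L : Type u) [LieRing L] [LieAlgebra k L]
    (X : Type u) (π : FreeLieAlgebra k X →ₗ⁅k⁆ L) (hπ : Function.Surjective π)
    (I : LieIdeal k L) (S : LieIdeal k (FreeLieAlgebra k X)) (hS : S = LieIdeal.comap π I)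
    (A : Submodule k (FreeLieAlgebra k X))
    (hA : A = (S ⊓
      LieModule.lowerCentralSeries k (FreeLieAlgebra k X) (FreeLieAlgebra k X) 2).toSubmodule)
    (B : Submodule k (FreeLieAlgebra k X))
    (hB : B = ((π.ker ⊓
        LieModule.lowerCentralSeries k (FreeLieAlgebra k X) (FreeLieAlgebra k X) 2) ⊔
      ⁅(⁅S, (⊤ : LieIdeal k (FreeLieAlgebra k X))⁆ : LieIdeal k (FreeLieAlgebra k X)),
        (⊤ : LieIdeal k (FreeLieAlgebra k X))⁆ : LieIdeal k (FreeLieAlgebra k X)).toSubmodule)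
    (C : Submodule k L) (hC : C = (I ⊓ LieModule.lowerCentralSeries k L L 2).toSubmodule)
    (D : Submodule k L)
    (hD : D = (⁅(⁅I, (⊤ : LieIdeal k L)⁆ : LieIdeal k L), (⊤ : LieIdeal k L)⁆ :
      LieIdeal k L).toSubmodule) :
    Nonempty ((↥A ⧸ B.comap A.subtype) ≃ₗ[k] (↥C ⧸ D.comap C.subtype)) := by
  subst hS
  have hS' : LieIdeal.map π (LieIdeal.comap π I) = I := by
    rw [LieIdeal.map_comap_eq (LieHom.isIdealMorphism_of_surjective π hπ),
      π.idealRange_eq_top_of_surjective hπ, top_inf_eq]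
  have hT : LieIdeal.map π ⊤ = ⊤ := by
    rw [← π.idealRange_eq_map]
    exact π.idealRange_eq_top_of_surjective hπ
  have hF := LieIdeal.lowerCentralSeries_map_eq (R := k) 2 hπ
  have hM : LieIdeal.map π ⁅(⁅LieIdeal.comap π I, (⊤ : LieIdeal k (FreeLieAlgebra k X))⁆ :
      LieIdeal k (FreeLieAlgebra k X)), (⊤ : LieIdeal k (FreeLieAlgebra k X))⁆ =
      ⁅(⁅I, (⊤ : LieIdeal k L)⁆ : LieIdeal k L), (⊤ : LieIdeal k L)⁆ := by
    rw [LieIdeal.map_bracket_eq π hπ, LieIdeal.map_bracket_eq π hπ, hS', hT]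
  have hle : ⁅(⁅LieIdeal.comap π I, (⊤ : LieIdeal k (FreeLieAlgebra k X))⁆ :
      LieIdeal k (FreeLieAlgebra k X)), (⊤ : LieIdeal k (FreeLieAlgebra k X))⁆ ≤
      LieModule.lowerCentralSeries k (FreeLieAlgebra k X) (FreeLieAlgebra k X) 2 := by
    rw [LieSubmodule.lie_comm, LieModule.lowerCentralSeries_succ,
      LieModule.lowerCentralSeries_succ, LieModule.lowerCentralSeries_zero]
    exact LieSubmodule.mono_lie_right _ (LieSubmodule.mono_lie_left _ le_top)
  generalize ⁅(⁅LieIdeal.comap π I, (⊤ : LieIdeal k (FreeLieAlgebra k X))⁆ :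
      LieIdeal k (FreeLieAlgebra k X)), (⊤ : LieIdeal k (FreeLieAlgebra k X))⁆ = M at *
  generalize ⁅(⁅I, (⊤ : LieIdeal k L)⁆ : LieIdeal k L), (⊤ : LieIdeal k L)⁆ = N at *
  have hAC : ∀ x ∈ A, (π : FreeLieAlgebra k X →ₗ[k] L) x ∈ C := by
    subst hA hC
    rintro x ⟨h1, h2⟩
    refine ⟨LieIdeal.mem_comap.1 h1, ?_⟩
    have := LieIdeal.mem_map (f := π) h2
    rw [hF] at this
    exact this
  let φ : A →ₗ[k] C := (π : FreeLieAlgebra k X →ₗ[k] L).restrict hAC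
  have hφ : Function.Surjective φ := by
    rintro ⟨y, hy⟩
    have hy' := hy
    rw [hC] at hy'
    obtain ⟨h1, h2⟩ := hy'
    have h2' : y ∈ LieModule.lowerCentralSeries k L L 2 := h2
    rw [← hF] at h2'
    obtain ⟨x, hx⟩ := LieIdeal.mem_map_of_surjective hπ h2'
    refine ⟨⟨x, ?_⟩, Subtype.ext hx⟩
    rw [hA]
    refine ⟨LieIdeal.mem_comap.2 ?_, x.2⟩
    rw [hx]
    exact h1
  let ψ : A →ₗ[k] (C ⧸ D.comap C.subtype) := (D.comap C.subtype).mkQ ∘ₗ φ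
  have hψ : Function.Surjective ψ := (Submodule.mkQ_surjective _).comp hφ
  have hker : B.comap A.subtype = LinearMap.ker ψ := by
    ext ⟨x, hx⟩
    have e : (⟨x, hx⟩ : A) ∈ LinearMap.ker ψ ↔ π x ∈ N := by
      rw [LinearMap.mem_ker]
      change (D.comap C.subtype).mkQ (φ ⟨x, hx⟩) = 0 ↔ _
      rw [Submodule.mkQ_apply, Submodule.Quotient.mk_eq_zero, hD]
      rfl
    rw [e, hB, Submodule.mem_comap]
    change x ∈ _ ⊔ M ↔ _
    rw [LieSubmodule.mem_sup]
    constructor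
    · rintro ⟨a, ha, b, hb, rfl⟩
      have ha' : π a = 0 := (LieHom.mem_ker).1 ha.1
      rw [map_add, ha', zero_add, ← hM]
      exact LieIdeal.mem_map hb
    · intro h
      rw [← hM] at h
      obtain ⟨b, hb⟩ := LieIdeal.mem_map_of_surjective hπ h
      rw [hA] at hx
      refine ⟨x - b, ⟨?_, ?_⟩, b, b.2, sub_add_cancel _ _⟩
      · change x - b ∈ π.ker
        rw [LieHom.mem_ker, map_sub, hb, sub_self]
      · exact sub_mem (S := LieIdeal k (FreeLieAlgebra k X)) hx.2 (hle b.2)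
  exact ⟨(Submodule.quotEquivOfEq _ _ hker).trans (ψ.quotKerEquivOfSurjective hψ)⟩
end
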